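/- Let k ≥ 3 and let S be a hypergraph with s edges which is an overlapping pair, a loose cycle, a (k,s/2,2)-star with s ≥ 4, a (k,s,a)-link with s ≥ 3 and 1 ≤ a ≤ ⌊k/(s−1)⌋, or a Pasch configuration. Suppose J is a finite connected k-uniform hypergraph that contains no bicycle and contains S. Then there exists an allowed edge order e_0,…,e_t of the edge set of J such that: (i) e_0,…,e_i forms an overlapping pair or loose cycle for some i, e_0,…,e_{s−1} forms S, and every edge e_j with s ≤ j ≤ t is either good or k-bad; and (ii) for all j with s+1 ≤ j ≤ t, if e_j is k-bad then either e_{j−1} is also k-bad, or there exists a vertex x ∈ e_j that is new in e_{j−1}. -/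

import Mathlib

variable {V : Type*} [DecidableEq V]

/-! ### Hypergraphs, edge orders, and configurations.
A (finite) hypergraph is represented by its finite set of edges, each edge being a
finite set of vertices; an edge order is a duplicate-free list of edges. -/

/-- The vertex set of a list of edges. -/
def vset (l : List (Finset V)) : Finset V := l.foldr (· ∪ ·) ∅

/-- The set of old vertices of the `i`-th edge of an edge order: those vertices of the
`i`-th edge appearing in some earlier edge. -/
def oldOf (l : List (Finset V)) (i : ℕ) : Finset V := l.getD i ∅ ∩ vset (l.take i)

/-- The `i`-th edge is good: it has exactly one old vertex. -/
def GoodAt (l : List (Finset V)) (i : ℕ) : Prop := (oldOf l i).card = 1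

/-- The `i`-th edge is bad: it has between `2` and `k-1` old vertices. -/
def BadAt (k : ℕ) (l : List (Finset V)) (i : ℕ) : Prop :=
  2 ≤ (oldOf l i).card ∧ (oldOf l i).card ≤ k - 1

/-- The `i`-th edge is `k`-bad: all of its `k` vertices are old. -/
def KBadAt (k : ℕ) (l : List (Finset V)) (i : ℕ) : Prop := (oldOf l i).card = k

/-- An allowed edge order: every non-initial edge is good, bad or `k`-bad, i.e. has at
least one old vertex. -/
def Allowed (l : List (Finset V)) : Prop :=
  l.Nodup ∧ ∀ i, 0 < i → i < l.length → 1 ≤ (oldOf l i).card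

/-- A valid edge order: every non-initial edge is good or bad. -/
def Valid (k : ℕ) (l : List (Finset V)) : Prop :=
  l.Nodup ∧ ∀ i, 0 < i → i < l.length → 1 ≤ (oldOf l i).card ∧ (oldOf l i).card ≤ k - 1

/-- Consecutive edges of the order intersect. -/
def Chain (l : List (Finset V)) : Prop :=
  ∀ i, i + 1 < l.length → (l.getD i ∅ ∩ l.getD (i + 1) ∅).Nonempty

/-- An overlapping pair: two (distinct) edges sharing between `2` and `k-1` vertices. -/
def OverlapPair (k : ℕ) (l : List (Finset V)) : Prop :=
  ∃ e f : Finset V, l = [e, f] ∧ e ≠ f ∧ 2 ≤ (e ∩ f).card ∧ (e ∩ f).card ≤ k - 1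

/-- A loose cycle: at least three edges; cyclically consecutive edges meet in exactly one
vertex and all other pairs of edges are disjoint. -/
def LooseCycle (l : List (Finset V)) : Prop :=
  3 ≤ l.length ∧ l.Nodup ∧
  ∀ i j, i < j → j < l.length →
    (l.getD i ∅ ∩ l.getD j ∅).card =
      if j = i + 1 ∨ (i = 0 ∧ j = l.length - 1) then 1 else 0

/-- A loose path: consecutive edges meet in exactly one vertex and all other pairs of
edges are disjoint. -/
def LoosePath (l : List (Finset V)) : Prop :=
  l ≠ [] ∧ l.Nodup ∧
  ∀ i j, i < j → j < l.length →
    (l.getD i ∅ ∩ l.getD j ∅).card = if j = i + 1 then 1 else 0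

/-- An overlapping pair or a loose cycle. -/
def OPorLC (k : ℕ) (l : List (Finset V)) : Prop := OverlapPair k l ∨ LooseCycle l

/-- A spoiled cycle. -/
def SpoiledCycle (k : ℕ) (l : List (Finset V)) : Prop :=
  Valid k l ∧ Chain l ∧
  ∃ (e₁ e₂ : Finset V) (P₂ : List (Finset V)),
    l = e₁ :: e₂ :: P₂ ∧ OverlapPair k [e₁, e₂] ∧ LoosePath P₂ ∧
    ∃ x y : V, x ≠ y ∧
      vset [e₁, e₂] ∩ vset P₂ = {x, y} ∧
      (e₂ \ e₁) ∩ (P₂.getD 0 ∅ \ (if 2 ≤ P₂.length then P₂.getD 1 ∅ else e₁)) = {x} ∧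
      (e₁ \ e₂) ∩ (P₂.getD (P₂.length - 1) ∅ \
        (if 2 ≤ P₂.length then P₂.getD (P₂.length - 2) ∅ else e₂)) = {y}

/-- A double loose cycle. -/
def DoubleLooseCycle (k : ℕ) (l : List (Finset V)) : Prop :=
  Valid k l ∧ Chain l ∧
  ∃ P₁ P₂ : List (Finset V),
    l = P₁ ++ P₂ ∧ LooseCycle P₁ ∧ LoosePath P₂ ∧ 2 ≤ P₂.length ∧
    ∃ x y : V, x ≠ y ∧
      vset P₁ ∩ vset P₂ = {x, y} ∧
      (P₂.getD 0 ∅ \ P₂.getD 1 ∅) ∩ P₁.getD (P₁.length - 1) ∅ = {x} ∧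
      ∃ a < P₁.length, (P₂.getD (P₂.length - 1) ∅ \ P₂.getD (P₂.length - 2) ∅) ∩
        P₁.getD a ∅ = {y}

/-- A double overlapping pair. -/
def DoubleOverlapPair (k : ℕ) (l : List (Finset V)) : Prop :=
  Valid k l ∧ Chain l ∧
  ∃ e₁ e₂ e₃ e₄ : Finset V,
    l = [e₁, e₂, e₃, e₄] ∧ OverlapPair k [e₁, e₂] ∧ OverlapPair k [e₃, e₄] ∧
    (e₃ ∩ e₄).card ≤ k - 2 ∧
    ∃ x y : V, x ≠ y ∧
      vset [e₁, e₂] ∩ vset [e₃, e₄] = {x, y} ∧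
      (e₁ \ e₂) ∩ (e₄ \ e₃) = {x} ∧ (e₂ \ e₁) ∩ (e₃ \ e₄) = {y}

/-- An overlapping pair/loose cycle with handle. -/
def WithHandle (k : ℕ) (l : List (Finset V)) : Prop :=
  Valid k l ∧ Chain l ∧
  ∃ (l' : List (Finset V)) (e : Finset V),
    l = l' ++ [e] ∧ OPorLC k l' ∧ BadAt k l (l.length - 1)

/-- An overlapping pair/loose cycle to overlapping pair/loose cycle. -/
def CycleToCycle (k : ℕ) (l : List (Finset V)) : Prop :=
  Valid k l ∧ Chain l ∧
  ∃ P₁ P₂ P₃ : List (Finset V),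
    l = P₁ ++ P₂ ++ P₃ ∧ OPorLC k P₁ ∧ OPorLC k P₃ ∧
    ((P₂ = [] ∧ (vset P₁ ∩ vset P₃).card = 1) ∨
     (P₂ ≠ [] ∧ LoosePath P₂ ∧
       (vset P₁ ∩ vset P₂).card = 1 ∧ vset P₁ ∩ vset P₃ = ∅ ∧
       (vset P₂ ∩ vset P₃).card = 1 ∧
       (2 ≤ P₂.length →
         P₂.getD 1 ∅ ∩ vset P₁ = ∅ ∧ P₂.getD (P₂.length - 2) ∅ ∩ vset P₃ = ∅)))

/-- A bicycle. -/
def Bicycle (k : ℕ) (l : List (Finset V)) : Prop :=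
  SpoiledCycle k l ∨ DoubleOverlapPair k l ∨ DoubleLooseCycle k l ∨
    WithHandle k l ∨ CycleToCycle k l

/-- The hypergraph with edge set `E` contains a bicycle: some of its edges, under some
edge order, form one. -/
def ContainsBicycle (k : ℕ) (E : Finset (Finset V)) : Prop :=
  ∃ l : List (Finset V), l.toFinset ⊆ E ∧ Bicycle k l

/-- A Pasch configuration (for `k = 3`): four edges spanning six vertices, each vertex
lying in exactly two of the edges, one vertex for each of the six pairs of edges. -/
def Pasch (l : List (Finset V)) : Prop :=
  Allowed l ∧ l.length = 4 ∧ (vset l).card = 6 ∧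
  (∀ v ∈ vset l, ((Finset.range 4).filter fun i => v ∈ l.getD i ∅).card = 2) ∧
  ∀ i j, i < j → j < 4 → (l.getD i ∅ ∩ l.getD j ∅).card = 1

/-- A loose star with centre `c`: edges pairwise disjoint except for the common central
vertex `c`. -/
def LooseStar (l : List (Finset V)) (c : V) : Prop :=
  l ≠ [] ∧ l.Nodup ∧ (∀ e ∈ l, c ∈ e) ∧
  ∀ i j, i < j → j < l.length → l.getD i ∅ ∩ l.getD j ∅ = {c}

/-- A `(k,u,2)`-star: `2u` edges forming two loose `u`-stars whose edges are matched up so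
that matched edges share all their vertices except the two centres. -/
def StarKU2 (k u : ℕ) (l : List (Finset V)) : Prop :=
  Allowed l ∧ l.length = 2 * u ∧
  ∃ (c₁ c₂ : V) (l₁ l₂ : List (Finset V)),
    c₁ ≠ c₂ ∧ l₁.length = u ∧ l₂.length = u ∧
    (l₁ ++ l₂).Perm l ∧ LooseStar l₁ c₁ ∧ LooseStar l₂ c₂ ∧
    ∀ i < u, (l₁.getD i ∅).erase c₁ = (l₂.getD i ∅).erase c₂

/-- A `(k,u,a)`-link: `u` edges spanning `k+a` vertices, any two of which together contain
all `k+a` vertices. -/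
def KLink (k u a : ℕ) (l : List (Finset V)) : Prop :=
  Allowed l ∧ l.length = u ∧ (vset l).card = k + a ∧
  ∀ i j, i < j → j < u → (l.getD i ∅ ∪ l.getD j ∅).card = k + a

/-- The hypergraph with edge set `E` is connected. -/
def HyperConnected (E : Finset (Finset V)) : Prop :=
  ∀ F ⊆ E, F.Nonempty → (E \ F).Nonempty → ∃ e ∈ F, ∃ f ∈ E \ F, (e ∩ f).Nonempty

/-- The hypergraph with edge set `E` is `k`-uniform. -/
def Uniform (k : ℕ) (E : Finset (Finset V)) : Prop := ∀ e ∈ E, e.card = k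

/-- The possible configurations `S` appearing in Claims 3.7 and 3.8 of the paper: an
overlapping pair, a loose cycle, a `(k,s/2,2)`-star with `s ≥ 4`, a `(k,s,a)`-link with
`s ≥ 3` and `1 ≤ a ≤ ⌊k/(s-1)⌋`, or a Pasch configuration. -/
def SConfig {V : Type*} [DecidableEq V] (k s : ℕ) (σ : List (Finset V)) : Prop :=
  σ.length = s ∧
  (OverlapPair k σ ∨ LooseCycle σ ∨
   (4 ≤ s ∧ ∃ u, s = 2 * u ∧ StarKU2 k u σ) ∨
   (3 ≤ s ∧ ∃ a, 1 ≤ a ∧ a ≤ k / (s - 1) ∧ KLink k s a σ) ∨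
   (k = 3 ∧ Pasch σ))

set_option linter.unusedSectionVars false
set_option linter.unusedVariables false

/-! ### Basic facts -/

section Basics

@[simp] lemma vset_nil : vset ([] : List (Finset V)) = ∅ := rfl

@[simp] lemma vset_cons (e : Finset V) (l : List (Finset V)) : vset (e :: l) = e ∪ vset l := rfl

lemma mem_vset {l : List (Finset V)} {v : V} : v ∈ vset l ↔ ∃ e ∈ l, v ∈ e := by
  induction l with
  | nil => simp
  | cons a l ih => simp [ih]

@[simp] lemma vset_append (A B : List (Finset V)) : vset (A ++ B) = vset A ∪ vset B := by
  ext v; simp only [mem_vset, Finset.mem_union, List.mem_append]; grind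

lemma subset_vset {l : List (Finset V)} {e : Finset V} (h : e ∈ l) : e ⊆ vset l :=
  fun v hv => mem_vset.2 ⟨e, h, hv⟩

lemma vset_congr {A B : List (Finset V)} (h : ∀ e, e ∈ A ↔ e ∈ B) : vset A = vset B := by
  ext v; simp only [mem_vset, h]

lemma getD_mem' {l : List (Finset V)} {i : ℕ} (h : i < l.length) : l.getD i ∅ ∈ l := by
  rw [List.getD_eq_getElem _ _ h]; exact List.getElem_mem h

lemma lt_of_mem_getD {l : List (Finset V)} {i : ℕ} {v : V} (h : v ∈ l.getD i ∅) :
    i < l.length := by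
  by_contra hc
  rw [List.getD_eq_default _ _ (by omega)] at h
  simp at h

lemma exists_getD {l : List (Finset V)} {e : Finset V} (h : e ∈ l) :
    ∃ i < l.length, l.getD i ∅ = e := by
  obtain ⟨i, hi, rfl⟩ := List.getElem_of_mem h
  exact ⟨i, hi, List.getD_eq_getElem _ _ hi⟩

lemma mem_vset_getD {l : List (Finset V)} {v : V} : v ∈ vset l ↔ ∃ i, v ∈ l.getD i ∅ := by
  rw [mem_vset]
  constructor
  · rintro ⟨e, he, hv⟩
    obtain ⟨i, -, rfl⟩ := exists_getD he
    exact ⟨i, hv⟩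
  · rintro ⟨i, hv⟩
    exact ⟨_, getD_mem' (lt_of_mem_getD hv), hv⟩

lemma getD_take' (l : List (Finset V)) (j i : ℕ) :
    (l.take j).getD i ∅ = if i < j then l.getD i ∅ else ∅ := by
  simp only [List.getD_eq_getElem?_getD, List.getElem?_take]
  split_ifs <;> simp

lemma getD_drop' (l : List (Finset V)) (j i : ℕ) :
    (l.drop j).getD i ∅ = l.getD (j + i) ∅ := by
  simp only [List.getD_eq_getElem?_getD, List.getElem?_drop]

lemma getD_append' (A B : List (Finset V)) (i : ℕ) :
    (A ++ B).getD i ∅ = if i < A.length then A.getD i ∅ else B.getD (i - A.length) ∅ := by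
  split_ifs with h
  · exact List.getD_append _ _ _ _ h
  · exact List.getD_append_right _ _ _ _ (by omega)

lemma mem_vset_take {l : List (Finset V)} {j : ℕ} {v : V} :
    v ∈ vset (l.take j) ↔ ∃ i < j, v ∈ l.getD i ∅ := by
  rw [mem_vset_getD]
  simp only [getD_take']
  constructor
  · rintro ⟨i, hi⟩
    split_ifs at hi with h
    · exact ⟨i, h, hi⟩
    · simp at hi
  · rintro ⟨i, h, hi⟩
    exact ⟨i, by simpa [h] using hi⟩

lemma oldOf_append_left {A B : List (Finset V)} {i : ℕ} (hi : i < A.length) :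
    oldOf (A ++ B) i = oldOf A i := by
  unfold oldOf
  rw [getD_append', if_pos hi, List.take_append_of_le_length hi.le]

lemma oldOf_append_right (A B : List (Finset V)) (i : ℕ) :
    oldOf (A ++ B) (A.length + i) = B.getD i ∅ ∩ (vset A ∪ vset (B.take i)) := by
  unfold oldOf
  rw [getD_append', if_neg (by omega), List.take_length_add_append, vset_append]
  simp

lemma oldOf_snoc (A : List (Finset V)) (e : Finset V) :
    oldOf (A ++ [e]) A.length = e ∩ vset A := by
  have := oldOf_append_right A [e] 0
  simpa using this

/-- Lists of `k`-sets. -/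
def UL (k : ℕ) (l : List (Finset V)) : Prop := ∀ e ∈ l, e.card = k

lemma UL.append {k : ℕ} {A B : List (Finset V)} (hA : UL k A) (hB : UL k B) : UL k (A ++ B) := by
  intro e he
  rcases List.mem_append.1 he with h | h
  exacts [hA e h, hB e h]

lemma nodup_of_getD {l : List (Finset V)}
    (h : ∀ i j, i < j → j < l.length → l.getD i ∅ ≠ l.getD j ∅) : l.Nodup := by
  rw [List.Nodup, List.pairwise_iff_getElem]
  intro i j hi hj hij
  have := h i j hij hj
  rwa [List.getD_eq_getElem _ _ hi, List.getD_eq_getElem _ _ hj] at this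

lemma valid_of {k : ℕ} (hk : 3 ≤ k) {l : List (Finset V)} (hU : UL k l)
    (h : ∀ i, 0 < i → i < l.length → 1 ≤ (oldOf l i).card ∧ (oldOf l i).card ≤ k - 1) :
    Valid k l := by
  refine ⟨nodup_of_getD ?_, h⟩
  intro i j hij hj heq
  have h1 := (h j (by omega) hj).2
  have h2 : oldOf l j = l.getD j ∅ := by
    unfold oldOf
    refine Finset.inter_eq_left.2 ?_
    intro v hv
    exact mem_vset_take.2 ⟨i, hij, heq ▸ hv⟩
  rw [h2, hU _ (getD_mem' hj)] at h1
  omega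

lemma valid_append {k : ℕ} (hk : 3 ≤ k) {A B : List (Finset V)} (hA : Valid k A)
    (hUA : UL k A) (hUB : UL k B)
    (h : ∀ i < B.length, 1 ≤ (B.getD i ∅ ∩ (vset A ∪ vset (B.take i))).card ∧
      (B.getD i ∅ ∩ (vset A ∪ vset (B.take i))).card ≤ k - 1) : Valid k (A ++ B) := by
  refine valid_of hk (hUA.append hUB) ?_
  intro i hi hil
  by_cases hc : i < A.length
  · rw [oldOf_append_left hc]; exact hA.2 i hi hc
  · obtain ⟨j, rfl⟩ : ∃ j, i = A.length + j := ⟨i - A.length, by omega⟩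
    rw [oldOf_append_right]
    exact h j (by simp at hil; omega)

lemma valid_snoc {k : ℕ} (hk : 3 ≤ k) {A : List (Finset V)} {e : Finset V} (hA : Valid k A)
    (hUA : UL k A) (he : e.card = k) (h1 : 1 ≤ (e ∩ vset A).card)
    (h2 : (e ∩ vset A).card ≤ k - 1) : Valid k (A ++ [e]) := by
  refine valid_append hk hA hUA (by intro x hx; simp at hx; rw [hx, he]) ?_
  intro i hi
  have : i = 0 := by simpa using hi
  subst this
  simp only [List.getD_cons_zero, List.take_zero, vset_nil, Finset.union_empty]
  exact ⟨h1, h2⟩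

/-- Gluing two valid orders at one vertex. -/
lemma valid_glue {k : ℕ} (hk : 3 ≤ k) {A B : List (Finset V)} (hA : Valid k A) (hB : Valid k B)
    (hUA : UL k A) (hUB : UL k B) {p : V} (hp : vset A ∩ vset B = {p}) (hpB : p ∈ B.getD 0 ∅) :
    Valid k (A ++ B) := by
  refine valid_append hk hA hUA hUB ?_
  intro i hi
  have hpA : p ∈ vset A := by
    have : p ∈ vset A ∩ vset B := by rw [hp]; simp
    exact (Finset.mem_inter.1 this).1
  rcases Nat.eq_zero_or_pos i with rfl | hi0
  · have : B.getD 0 ∅ ∩ (vset A ∪ vset (B.take 0)) = {p} := by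
      ext v
      simp only [List.take_zero, vset_nil, Finset.union_empty, Finset.mem_inter,
        Finset.mem_singleton]
      constructor
      · rintro ⟨h1, h2⟩
        have : v ∈ vset A ∩ vset B := Finset.mem_inter.2 ⟨h2, mem_vset_getD.2 ⟨_, h1⟩⟩
        rw [hp] at this; simpa using this
      · rintro rfl; exact ⟨hpB, hpA⟩
    rw [this]; simp; omega
  · have : B.getD i ∅ ∩ (vset A ∪ vset (B.take i)) = oldOf B i := by
      unfold oldOf
      ext v
      simp only [Finset.mem_inter, Finset.mem_union]
      constructor
      · rintro ⟨h1, h2 | h2⟩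
        · have : v ∈ vset A ∩ vset B := Finset.mem_inter.2 ⟨h2, mem_vset_getD.2 ⟨_, h1⟩⟩
          rw [hp] at this
          have hv : v = p := by simpa using this
          subst hv
          exact ⟨h1, mem_vset_take.2 ⟨0, hi0, hpB⟩⟩
        · exact ⟨h1, h2⟩
      · rintro ⟨h1, h2⟩; exact ⟨h1, Or.inr h2⟩
    rw [this]
    exact hB.2 i hi0 hi

lemma chain_append {A B : List (Finset V)} (hA : Chain A) (hB : Chain B)
    (h : B ≠ [] → (A.getD (A.length - 1) ∅ ∩ B.getD 0 ∅).Nonempty) : Chain (A ++ B) := by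
  intro i hi
  rw [List.length_append] at hi
  rw [getD_append', getD_append']
  by_cases h1 : i + 1 < A.length
  · rw [if_pos (by omega), if_pos h1]; exact hA i h1
  · rw [if_neg h1]
    by_cases h2 : i < A.length
    · rw [if_pos h2]
      have e1 : i = A.length - 1 := by omega
      have e2 : i + 1 - A.length = 0 := by omega
      rw [e2, e1]
      exact h (by rintro rfl; simp at hi; omega)
    · rw [if_neg h2]
      have := hB (i - A.length) (by omega)
      rwa [show i + 1 - A.length = i - A.length + 1 by omega]

lemma chain_single (e : Finset V) : Chain [e] := by
  intro i hi; simp at hi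

end Basics

section Shapes

variable {k : ℕ}

lemma LooseCycle.chain {l : List (Finset V)} (h : LooseCycle l) : Chain l := by
  intro i hi
  have := h.2.2 i (i + 1) (by omega) hi
  rw [if_pos (Or.inl rfl)] at this
  rw [← Finset.card_pos]; omega

lemma LoosePath.chain {l : List (Finset V)} (h : LoosePath l) : Chain l := by
  intro i hi
  have := h.2.2 i (i + 1) (by omega) hi
  rw [if_pos rfl] at this
  rw [← Finset.card_pos]; omega

lemma OverlapPair.chain {l : List (Finset V)} (h : OverlapPair k l) : Chain l := by
  obtain ⟨e, f, rfl, -, h2, -⟩ := h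
  intro i hi
  have : i = 0 := by simp at hi; omega
  subst this
  rw [← Finset.card_pos]; simpa using (by omega : 0 < (e ∩ f).card)

lemma OPorLC.chain {l : List (Finset V)} (h : OPorLC k l) : Chain l := by
  rcases h with h | h
  exacts [h.chain, h.chain]

lemma OPorLC.two_le {l : List (Finset V)} (h : OPorLC k l) : 2 ≤ l.length := by
  rcases h with ⟨e, f, rfl, -⟩ | h
  · simp
  · have := h.1; omega

lemma LoosePath.old {l : List (Finset V)} (h : LoosePath l) {i : ℕ} (hi0 : 0 < i)
    (hi : i < l.length) : l.getD i ∅ ∩ vset (l.take i) = l.getD (i - 1) ∅ ∩ l.getD i ∅ := by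
  ext v
  simp only [Finset.mem_inter, mem_vset_take]
  constructor
  · rintro ⟨h1, j, hj, h2⟩
    have := h.2.2 j i hj hi
    split_ifs at this with hc
    · subst hc; exact ⟨by simpa using h2, h1⟩
    · rw [Finset.card_eq_zero] at this
      have h3 : v ∈ l.getD j ∅ ∩ l.getD i ∅ := Finset.mem_inter.2 ⟨h2, h1⟩
      rw [this] at h3; simp at h3
  · rintro ⟨h1, h2⟩
    exact ⟨h2, i - 1, by omega, h1⟩

lemma LoosePath.old_card {l : List (Finset V)} (h : LoosePath l) {i : ℕ} (hi0 : 0 < i)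
    (hi : i < l.length) : (l.getD i ∅ ∩ vset (l.take i)).card = 1 := by
  rw [h.old hi0 hi, h.2.2 (i - 1) i (by omega) hi, if_pos (by omega)]

lemma OPorLC.valid (hk : 3 ≤ k) {l : List (Finset V)} (h : OPorLC k l) : Valid k l := by
  rcases h with ⟨e, f, rfl, h1, h2, h3⟩ | h
  · refine ⟨by simpa using h1, ?_⟩
    intro i hi hil
    have : i = 1 := by simp at hil; omega
    subst this
    have : oldOf [e, f] 1 = e ∩ f := by simp [oldOf, Finset.inter_comm]
    rw [this]; omega
  · refine ⟨h.2.1, ?_⟩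
    intro i hi0 hi
    have hsub : l.getD (i - 1) ∅ ∩ l.getD i ∅ ⊆ oldOf l i := by
      intro v hv
      rw [Finset.mem_inter] at hv
      exact Finset.mem_inter.2 ⟨hv.2, mem_vset_take.2 ⟨i - 1, by omega, hv.1⟩⟩
    have hc1 := h.2.2 (i - 1) i (by omega) hi
    rw [if_pos (by omega)] at hc1
    have hsup : oldOf l i ⊆ (l.getD (i - 1) ∅ ∩ l.getD i ∅) ∪ (if i = l.length - 1 then
        l.getD 0 ∅ ∩ l.getD i ∅ else ∅) := by
      intro v hv
      obtain ⟨hv1, hv2⟩ := Finset.mem_inter.1 hv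
      obtain ⟨j, hj, hv2⟩ := mem_vset_take.1 hv2
      have := h.2.2 j i hj hi
      have h3 : v ∈ l.getD j ∅ ∩ l.getD i ∅ := Finset.mem_inter.2 ⟨hv2, hv1⟩
      split_ifs at this with hc
      · rcases hc with rfl | ⟨rfl, hc⟩
        · simp only [Nat.add_sub_cancel]
          exact Finset.mem_union_left _ h3
        · rw [if_pos hc]; exact Finset.mem_union_right _ h3
      · rw [Finset.card_eq_zero] at this
        rw [this] at h3; simp at h3
    have hc2 : (if i = l.length - 1 then l.getD 0 ∅ ∩ l.getD i ∅ else ∅).card ≤ 1 := by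
      split_ifs with hc
      · rw [h.2.2 0 i hi0 hi, if_pos (Or.inr ⟨rfl, hc⟩)]
      · simp
    have := Finset.card_le_card hsub
    have := (Finset.card_le_card hsup).trans (Finset.card_union_le _ _)
    omega

lemma LooseCycle.rotate {A B : List (Finset V)} (h : LooseCycle (A ++ B)) :
    LooseCycle (B ++ A) := by
  obtain ⟨h1, h2, h3⟩ := h
  rw [List.length_append] at h1
  refine ⟨by rw [List.length_append]; omega, List.nodup_append_comm.1 h2, ?_⟩
  intro i j hij hj
  rw [List.length_append] at hj
  have key : ∀ i, (B ++ A).getD i ∅ =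
      (A ++ B).getD (if i < B.length then i + A.length else i - B.length) ∅ ∨
        B.length + A.length ≤ i := by
    intro i
    by_cases hh : B.length + A.length ≤ i
    · exact Or.inr hh
    · left
      rw [getD_append', getD_append']
      by_cases hc : i < B.length
      · simp [hc]
      · simp only [hc, if_false]
        rw [if_pos (by omega)]
  have ki := (key i).resolve_right (by omega)
  have kj := (key j).resolve_right (by omega)
  rw [ki, kj]
  simp only [List.length_append] at h3 ⊢
  by_cases hi' : i < B.length <;> by_cases hj' : j < B.length
  · rw [if_pos hi', if_pos hj', h3 _ _ (by omega) (by omega)]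
    congr 1; simp only [eq_iff_iff]; omega
  · rw [if_pos hi', if_neg hj', Finset.inter_comm, h3 _ _ (by omega) (by omega)]
    congr 1; simp only [eq_iff_iff]; omega
  · omega
  · rw [if_neg hi', if_neg hj', h3 _ _ (by omega) (by omega)]
    congr 1; simp only [eq_iff_iff]; omega

lemma OverlapPair.swap {e f : Finset V} (h : OverlapPair k [e, f]) : OverlapPair k [f, e] := by
  obtain ⟨a, b, hab, h1, h2, h3⟩ := h
  simp only [List.cons.injEq, and_true] at hab
  obtain ⟨rfl, rfl⟩ := hab
  exact ⟨f, e, rfl, h1.symm, by rwa [Finset.inter_comm], by rwa [Finset.inter_comm]⟩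

lemma OPorLC.to_head {C : List (Finset V)} (h : OPorLC k C) {v : V} (hv : v ∈ vset C) :
    ∃ C', OPorLC k C' ∧ (∀ e, e ∈ C' ↔ e ∈ C) ∧ v ∈ C'.getD 0 ∅ := by
  rcases h with h | h
  · obtain ⟨e, f, rfl, h1⟩ := id h
    simp only [vset_cons, vset_nil, Finset.union_empty, Finset.mem_union] at hv
    rcases hv with hv | hv
    · exact ⟨[e, f], Or.inl h, fun _ => Iff.rfl, by simpa using hv⟩
    · exact ⟨[f, e], Or.inl h.swap, by intro x; simp [or_comm], by simpa using hv⟩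
  · obtain ⟨e, he, hve⟩ := mem_vset.1 hv
    obtain ⟨A, B, rfl⟩ := List.append_of_mem he
    exact ⟨e :: B ++ A, Or.inr h.rotate, by intro x; simp; tauto, by simpa using hve⟩

lemma LooseCycle.to_last {C : List (Finset V)} (h : LooseCycle C) {v : V} (hv : v ∈ vset C) :
    ∃ C', LooseCycle C' ∧ (∀ e, e ∈ C' ↔ e ∈ C) ∧ v ∈ C'.getD (C'.length - 1) ∅ := by
  obtain ⟨e, he, hve⟩ := mem_vset.1 hv
  obtain ⟨A, B, rfl⟩ := List.append_of_mem he
  have : A ++ e :: B = (A ++ [e]) ++ B := by simp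
  rw [this] at h
  refine ⟨B ++ (A ++ [e]), h.rotate, by intro x; simp; tauto, ?_⟩
  rw [← List.append_assoc, getD_append']
  simpa using hve

lemma OPorLC.to_last {C : List (Finset V)} (h : OPorLC k C) {v : V} (hv : v ∈ vset C) :
    ∃ C', OPorLC k C' ∧ (∀ e, e ∈ C' ↔ e ∈ C) ∧ v ∈ C'.getD (C'.length - 1) ∅ := by
  rcases h with h | h
  · obtain ⟨e, f, rfl, h1⟩ := id h
    simp only [vset_cons, vset_nil, Finset.union_empty, Finset.mem_union] at hv
    rcases hv with hv | hv
    · exact ⟨[f, e], Or.inl h.swap, by intro x; simp [or_comm], by simpa using hv⟩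
    · exact ⟨[e, f], Or.inl h, fun _ => Iff.rfl, by simpa using hv⟩
  · obtain ⟨C', h1, h2, h3⟩ := h.to_last hv
    exact ⟨C', Or.inr h1, h2, h3⟩

lemma LoosePath.cons {R : List (Finset V)} {g : Finset V} (h : LoosePath R) (hg : g ∉ R)
    (h0 : (g ∩ R.getD 0 ∅).card = 1) (h1 : ∀ i, 0 < i → i < R.length → g ∩ R.getD i ∅ = ∅) :
    LoosePath (g :: R) := by
  refine ⟨by simp, List.nodup_cons.2 ⟨hg, h.2.1⟩, ?_⟩
  intro i j hij hj
  obtain ⟨j, rfl⟩ : ∃ j', j = j' + 1 := ⟨j - 1, by omega⟩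
  simp only [List.length_cons] at hj
  rcases Nat.eq_zero_or_pos i with rfl | hi
  · rw [List.getD_cons_succ, List.getD_cons_zero]
    rcases Nat.eq_zero_or_pos j with rfl | hj0
    · simpa using h0
    · rw [h1 j hj0 (by omega), if_neg (by omega)]; rfl
  · obtain ⟨i, rfl⟩ : ∃ j', i = j' + 1 := ⟨i - 1, by omega⟩
    rw [List.getD_cons_succ, List.getD_cons_succ, h.2.2 i j (by omega) (by omega)]
    congr 1; simp

lemma loosePath_single (g : Finset V) : LoosePath [g] := by
  refine ⟨by simp, by simp, ?_⟩
  intro i j hij hj; simp at hj; omega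

lemma LooseCycle.of_cons {R : List (Finset V)} {f : Finset V} (h : LoosePath R) (hf : f ∉ R)
    (hl : 2 ≤ R.length) (h0 : ∀ i < R.length, (f ∩ R.getD i ∅).card =
      if i = 0 ∨ i = R.length - 1 then 1 else 0) :
    LooseCycle (f :: R) := by
  refine ⟨by simp; omega, List.nodup_cons.2 ⟨hf, h.2.1⟩, ?_⟩
  intro i j hij hj
  obtain ⟨j, rfl⟩ : ∃ j', j = j' + 1 := ⟨j - 1, by omega⟩
  simp only [List.length_cons] at hj ⊢
  rcases Nat.eq_zero_or_pos i with rfl | hi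
  · rw [List.getD_cons_succ, List.getD_cons_zero, h0 j (by omega)]
    refine if_congr ?_ rfl rfl
    omega
  · obtain ⟨i, rfl⟩ : ∃ j', i = j' + 1 := ⟨i - 1, by omega⟩
    rw [List.getD_cons_succ, List.getD_cons_succ, h.2.2 i j (by omega) (by omega)]
    simp

/-- A segment of a loose cycle which is not everything is a loose path. -/
lemma LooseCycle.segment {C : List (Finset V)} (h : LooseCycle C) {a b : ℕ} (hab : a < b)
    (hb : b < C.length) (hn : ¬ (a = 0 ∧ b = C.length - 1)) :
    LoosePath ((C.drop a).take (b - a + 1)) := by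
  have hlen : ((C.drop a).take (b - a + 1)).length = b - a + 1 := by simp; omega
  refine ⟨by intro h0; rw [h0] at hlen; simp at hlen, ?_, ?_⟩
  · exact (h.2.1.sublist (List.drop_sublist _ _)).sublist (List.take_sublist _ _)
  · intro i j hij hj
    rw [hlen] at hj
    rw [getD_take', getD_take', if_pos (by omega), if_pos hj, getD_drop', getD_drop',
      h.2.2 _ _ (by omega) (by omega)]
    congr 1; simp only [eq_iff_iff]; omega

/-- Attaching a loose path to a valid order. -/
lemma valid_attach (hk : 3 ≤ k) {A L : List (Finset V)} (hA : Valid k A) (hUA : UL k A)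
    (hUL : UL k L) (hL : LoosePath L) (h0 : 1 ≤ (L.getD 0 ∅ ∩ vset A).card)
    (h1 : ∀ i < L.length, (L.getD i ∅ ∩ vset A).card ≤ 1) : Valid k (A ++ L) := by
  refine valid_append hk hA hUA hUL ?_
  intro i hi
  rw [Finset.inter_union_distrib_left]
  rcases Nat.eq_zero_or_pos i with rfl | hi0
  · have := h1 0 hi
    simp only [List.take_zero, vset_nil, Finset.inter_empty, Finset.union_empty]
    omega
  · have h2 := hL.old_card hi0 hi
    have h3 := h1 i hi
    have h4 := Finset.card_union_le (L.getD i ∅ ∩ vset A) (L.getD i ∅ ∩ vset (L.take i))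
    have h5 := Finset.card_le_card
      (Finset.subset_union_right (s₁ := L.getD i ∅ ∩ vset A) (s₂ := L.getD i ∅ ∩ vset (L.take i)))
    omega

end Shapes
/-! ### Constructions of bicycles -/

section Bicycles

variable {k : ℕ} {E : Finset (Finset V)}

lemma ul_of (hunif : Uniform k E) {l : List (Finset V)} (h : ∀ e ∈ l, e ∈ E) : UL k l :=
  fun e he => hunif e (h e he)

lemma toFinset_sub {l : List (Finset V)} (h : ∀ e ∈ l, e ∈ E) : l.toFinset ⊆ E :=
  fun e he => h e (List.mem_toFinset.1 he)

lemma bic_handle (hk : 3 ≤ k) (hunif : Uniform k E) {C : List (Finset V)} {f : Finset V}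
    (hC : OPorLC k C) (hCE : ∀ e ∈ C, e ∈ E) (hf : f ∈ E) (h2 : 2 ≤ (f ∩ vset C).card)
    (h3 : (f ∩ vset C).card ≤ k - 1) : ContainsBicycle k E := by
  obtain ⟨v, hv⟩ : (f ∩ vset C).Nonempty := Finset.card_pos.1 (by omega)
  rw [Finset.mem_inter] at hv
  obtain ⟨C', h1, hm, hl⟩ := hC.to_last hv.2
  have hV := vset_congr hm
  have hCE' : ∀ e ∈ C', e ∈ E := fun e he => hCE e ((hm e).1 he)
  rw [← hV] at h2 h3
  refine ⟨C' ++ [f], toFinset_sub ?_, Or.inr (Or.inr (Or.inr (Or.inl ⟨?_, ?_, C', f, rfl, h1, ?_⟩)))⟩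
  · intro e he
    rcases List.mem_append.1 he with he | he
    · exact hCE' e he
    · simp at he; rwa [he]
  · exact valid_snoc hk (h1.valid hk) (ul_of hunif hCE') (hunif f hf) (by omega) h3
  · refine chain_append h1.chain (chain_single f) fun _ => ⟨v, ?_⟩
    simp only [List.getD_cons_zero]
    exact Finset.mem_inter.2 ⟨hl, hv.1⟩
  · have : (C' ++ [f]).length - 1 = C'.length := by simp
    rw [this]
    unfold BadAt
    rw [oldOf_snoc]
    exact ⟨h2, h3⟩

/-- New vertices of the last edge of a (reversed) path starting at `W`. -/
def front (W : Finset V) : List (Finset V) → Finset V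
  | [] => W
  | g :: R => g \ (W ∪ vset R)

/-- Reversed loose paths starting at `W`. -/
def PathR (W : Finset V) : List (Finset V) → Prop
  | [] => True
  | g :: R => PathR W R ∧ ∃ v ∈ front W R, g ∩ (W ∪ vset R) = {v}

/-- A loose path only whose last edge meets `W`, in the vertex `q`. -/
def Hang (W : Finset V) (R : List (Finset V)) (q : V) : Prop :=
  LoosePath R ∧ ∀ i < R.length, R.getD i ∅ ∩ W = if i = R.length - 1 then {q} else ∅

/-- A loose path only whose first and last edges meet `W`, in distinct vertices `x`, `y`. -/
def Conn (W : Finset V) (L : List (Finset V)) (x y : V) : Prop :=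
  LoosePath L ∧ 2 ≤ L.length ∧ x ≠ y ∧ ∀ i < L.length, L.getD i ∅ ∩ W =
    if i = 0 then {x} else if i = L.length - 1 then {y} else ∅

lemma front_subset (W : Finset V) (R : List (Finset V)) : front W R ⊆ W ∪ vset R := by
  cases R with
  | nil => simp [front]
  | cons g R =>
    intro v hv
    simp only [front, Finset.mem_sdiff] at hv
    simp [hv.1]

lemma PathR.hang (hk : 3 ≤ k) {W : Finset V} {R : List (Finset V)} (hU : UL k R)
    (h : PathR W R) (hR : R ≠ []) : ∃ q, Hang W R q := by
  induction R with
  | nil => exact absurd rfl hR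
  | cons g R ih =>
    obtain ⟨h1, v, hv, hg⟩ := h
    have hUR : UL k R := fun e he => hU e (List.mem_cons_of_mem _ he)
    cases R with
    | nil =>
      refine ⟨v, loosePath_single g, ?_⟩
      intro i hi
      have : i = 0 := by simpa using hi
      subst this
      simpa using hg
    | cons h R =>
      obtain ⟨q, hq1, hq2⟩ := ih hUR h1 (by simp)
      simp only [front, Finset.mem_sdiff, Finset.mem_union, not_or] at hv
      have hgR : ∀ x ∈ g, x ∈ W ∪ vset (h :: R) → x = v := by
        intro x hx hx2
        have : x ∈ g ∩ (W ∪ vset (h :: R)) := Finset.mem_inter.2 ⟨hx, hx2⟩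
        rw [hg] at this; simpa using this
      have hvg : v ∈ g := by
        have : v ∈ g ∩ (W ∪ vset (h :: R)) := by rw [hg]; simp
        exact (Finset.mem_inter.1 this).1
      refine ⟨q, hq1.cons ?_ ?_ ?_, ?_⟩
      · intro hmem
        have hc : g ∩ (W ∪ vset (h :: R)) = g :=
          Finset.inter_eq_left.2 ((subset_vset hmem).trans Finset.subset_union_right)
        rw [hc] at hg
        have := hU g (by simp)
        rw [hg] at this; simp at this; omega
      · have : g ∩ (h :: R).getD 0 ∅ = {v} := by
          ext x
          simp only [List.getD_cons_zero, Finset.mem_inter, Finset.mem_singleton]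
          constructor
          · rintro ⟨hx1, hx2⟩
            exact hgR x hx1 (by simp [hx2])
          · rintro rfl; exact ⟨hvg, hv.1⟩
        rw [this]; simp
      · intro i hi0 hi
        obtain ⟨i, rfl⟩ : ∃ j', i = j' + 1 := ⟨i - 1, by omega⟩
        rw [List.getD_cons_succ]
        rw [Finset.eq_empty_iff_forall_notMem]
        intro x hx
        rw [Finset.mem_inter] at hx
        have hxR : x ∈ vset R := mem_vset_getD.2 ⟨i, hx.2⟩
        have := hgR x hx.1 (by simp [hxR])
        subst this
        exact hv.2.2 hxR
      · intro i hi
        rcases Nat.eq_zero_or_pos i with rfl | hi0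
        · rw [if_neg (by simp), List.getD_cons_zero, Finset.eq_empty_iff_forall_notMem]
          intro x hx
          rw [Finset.mem_inter] at hx
          have := hgR x hx.1 (by simp [hx.2])
          subst this
          exact hv.2.1 hx.2
        · obtain ⟨i, rfl⟩ : ∃ j', i = j' + 1 := ⟨i - 1, by omega⟩
          rw [List.getD_cons_succ, hq2 i (by simpa using hi)]
          refine if_congr ?_ rfl rfl
          simp

lemma Hang.inter {W : Finset V} {R : List (Finset V)} {q : V} (h : Hang W R q) :
    vset R ∩ W = {q} := by
  have hl : 0 < R.length := List.length_pos_iff.2 h.1.1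
  ext x
  simp only [Finset.mem_inter, Finset.mem_singleton, mem_vset_getD]
  constructor
  · rintro ⟨⟨i, hi⟩, hx⟩
    have h2 := h.2 i (lt_of_mem_getD hi)
    have h3 : x ∈ R.getD i ∅ ∩ W := Finset.mem_inter.2 ⟨hi, hx⟩
    rw [h2] at h3
    split_ifs at h3
    · simpa using h3
    · simp at h3
  · rintro rfl
    have h2 := h.2 (R.length - 1) (by omega)
    rw [if_pos rfl] at h2
    have h3 : x ∈ R.getD (R.length - 1) ∅ ∩ W := by rw [h2]; simp
    rw [Finset.mem_inter] at h3
    exact ⟨⟨_, h3.1⟩, h3.2⟩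

lemma bic_ctc (hk : 3 ≤ k) (hunif : Uniform k E) {C R D : List (Finset V)}
    (hC : OPorLC k C) (hCE : ∀ e ∈ C, e ∈ E) (hD : OPorLC k D) (hDE : ∀ e ∈ D, e ∈ E)
    (hRE : ∀ e ∈ R, e ∈ E) (hR : PathR (vset C) R) {p : V} (hp : p ∈ front (vset C) R)
    (h : vset D ∩ (vset C ∪ vset R) = {p}) : ContainsBicycle k E := by
  have hpD : p ∈ vset D := by
    have : p ∈ vset D ∩ (vset C ∪ vset R) := by rw [h]; simp
    exact (Finset.mem_inter.1 this).1
  have hpu : ∀ x ∈ vset D, x ∈ vset C ∪ vset R → x = p := by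
    intro x h1 h2
    have : x ∈ vset D ∩ (vset C ∪ vset R) := Finset.mem_inter.2 ⟨h1, h2⟩
    rw [h] at this; simpa using this
  obtain ⟨D', hD1, hDm, hDl⟩ := hD.to_last hpD
  have hDV := vset_congr hDm
  have hDE' : ∀ e ∈ D', e ∈ E := fun e he => hDE e ((hDm e).1 he)
  cases R with
  | nil =>
    simp only [front] at hp
    obtain ⟨C', hC1, hCm, hCl⟩ := hC.to_head hp
    have hCV := vset_congr hCm
    have hCE' : ∀ e ∈ C', e ∈ E := fun e he => hCE e ((hCm e).1 he)
    have hDC : vset D' ∩ vset C' = {p} := by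
      rw [hDV, hCV]; simpa using h
    refine ⟨D' ++ C', toFinset_sub ?_, Or.inr (Or.inr (Or.inr (Or.inr
      ⟨?_, ?_, D', [], C', by simp, hD1, hC1, Or.inl ⟨rfl, by rw [hDC]; simp⟩⟩)))⟩
    · intro e he
      rcases List.mem_append.1 he with he | he
      exacts [hDE' e he, hCE' e he]
    · exact valid_glue hk (hD1.valid hk) (hC1.valid hk) (ul_of hunif hDE') (ul_of hunif hCE')
        hDC hCl
    · exact chain_append hD1.chain hC1.chain fun _ => ⟨p, Finset.mem_inter.2 ⟨hDl, hCl⟩⟩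
  | cons g R =>
    obtain ⟨q, hq⟩ := hR.hang hk (ul_of hunif hRE) (by simp)
    have hqi := hq.inter
    have hqC : q ∈ vset C := by
      have : q ∈ vset (g :: R) ∩ vset C := by rw [hqi]; simp
      exact (Finset.mem_inter.1 this).2
    have hqlast : q ∈ (g :: R).getD ((g :: R).length - 1) ∅ := by
      have h2 := hq.2 ((g :: R).length - 1) (by simp)
      rw [if_pos rfl] at h2
      have h3 : q ∈ (g :: R).getD ((g :: R).length - 1) ∅ ∩ vset C := by rw [h2]; simp
      exact (Finset.mem_inter.1 h3).1
    simp only [front, Finset.mem_sdiff, Finset.mem_union, not_or] at hp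
    obtain ⟨hpg, hpC, hpR⟩ := hp
    obtain ⟨C', hC1, hCm, hCl⟩ := hC.to_head hqC
    have hCV := vset_congr hCm
    have hCE' : ∀ e ∈ C', e ∈ E := fun e he => hCE e ((hCm e).1 he)
    have hDC : vset D' ∩ vset C' = ∅ := by
      rw [hDV, hCV, Finset.eq_empty_iff_forall_notMem]
      intro x hx
      rw [Finset.mem_inter] at hx
      have := hpu x hx.1 (by simp [hx.2])
      subst this
      exact hpC hx.2
    have hRDi : ∀ i, (g :: R).getD i ∅ ∩ vset D' ⊆ {p} := by
      intro i x hx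
      rw [Finset.mem_inter] at hx
      rw [Finset.mem_singleton]
      refine hpu x (hDV ▸ hx.2) (Finset.mem_union_right _ (mem_vset_getD.2 ⟨i, hx.1⟩))
    have hRD : vset D' ∩ vset (g :: R) = {p} := by
      ext x
      simp only [Finset.mem_inter, Finset.mem_singleton]
      constructor
      · rintro ⟨h1, h2⟩
        exact hpu x (hDV ▸ h1) (Finset.mem_union_right _ h2)
      · rintro rfl
        exact ⟨hDV ▸ hpD, by simp [hpg]⟩
    have hV1 : Valid k (D' ++ (g :: R)) := by
      refine valid_attach hk (hD1.valid hk) (ul_of hunif hDE') (ul_of hunif hRE) hq.1 ?_ ?_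
      · exact Finset.card_pos.2 ⟨p, by simp [hpg, hDV, hpD]⟩
      · intro i _
        simpa using Finset.card_le_card (hRDi i)
    have hall : vset (D' ++ (g :: R)) ∩ vset C' = {q} := by
      rw [vset_append, Finset.union_inter_distrib_right, hDC, hCV, hqi]; simp
    have hDRE : ∀ e ∈ D' ++ (g :: R), e ∈ E := by
      intro e he
      rcases List.mem_append.1 he with he | he
      exacts [hDE' e he, hRE e he]
    refine ⟨D' ++ (g :: R) ++ C', toFinset_sub ?_, Or.inr (Or.inr (Or.inr (Or.inr
      ⟨?_, ?_, D', g :: R, C', rfl, hD1, hC1, Or.inr ⟨by simp, hq.1, by rw [hRD]; simp, hDC,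
        ?_, ?_⟩⟩)))⟩
    · intro e he
      rcases List.mem_append.1 he with he | he
      exacts [hDRE e he, hCE' e he]
    · exact valid_glue hk hV1 (hC1.valid hk) (ul_of hunif hDRE) (ul_of hunif hCE') hall hCl
    · refine chain_append (chain_append hD1.chain hq.1.chain fun _ => ⟨p, ?_⟩) hC1.chain
        fun _ => ⟨q, ?_⟩
      · simp only [List.getD_cons_zero]
        exact Finset.mem_inter.2 ⟨hDl, hpg⟩
      · refine Finset.mem_inter.2 ⟨?_, hCl⟩
        rw [getD_append', if_neg (by simp)]
        convert hqlast using 2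
        simp only [List.length_append, List.length_cons]
        omega
    · rw [hCV, hqi]; simp
    · intro hl
      constructor
      · rw [Finset.eq_empty_iff_forall_notMem]
        intro x hx
        have h2 := hRDi 1 hx
        rw [Finset.mem_singleton] at h2
        subst h2
        rw [Finset.mem_inter, List.getD_cons_succ] at hx
        exact hpR (mem_vset_getD.2 ⟨0, hx.1⟩)
      · rw [hCV, hq.2 _ (by omega), if_neg (by omega)]

lemma Conn.inter {W : Finset V} {L : List (Finset V)} {x y : V} (h : Conn W L x y) :
    W ∩ vset L = {x, y} := by
  obtain ⟨h1, h2, h3, h4⟩ := h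
  have h0 := h4 0 (by omega)
  have hl := h4 (L.length - 1) (by omega)
  rw [if_pos rfl] at h0
  rw [if_neg (by omega), if_pos rfl] at hl
  ext v
  simp only [Finset.mem_inter, Finset.mem_insert, Finset.mem_singleton]
  constructor
  · rintro ⟨hv, hv2⟩
    obtain ⟨i, hi⟩ := mem_vset_getD.1 hv2
    have h5 : v ∈ L.getD i ∅ ∩ W := Finset.mem_inter.2 ⟨hi, hv⟩
    rw [h4 i (lt_of_mem_getD hi)] at h5
    split_ifs at h5
    · left; simpa using h5
    · right; simpa using h5
    · simp at h5
  · rintro (rfl | rfl)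
    · have : v ∈ L.getD 0 ∅ ∩ W := by rw [h0]; simp
      rw [Finset.mem_inter] at this
      exact ⟨this.2, mem_vset_getD.2 ⟨_, this.1⟩⟩
    · have : v ∈ L.getD (L.length - 1) ∅ ∩ W := by rw [hl]; simp
      rw [Finset.mem_inter] at this
      exact ⟨this.2, mem_vset_getD.2 ⟨_, this.1⟩⟩

lemma Conn.first {W : Finset V} {L : List (Finset V)} {x y : V} (h : Conn W L x y)
    {e : Finset V} (he : e ⊆ W) (hx : x ∈ e) : e ∩ (L.getD 0 ∅ \ L.getD 1 ∅) = {x} := by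
  obtain ⟨h1, h2, h3, h4⟩ := h
  have h0 := h4 0 (by omega)
  have hl := h4 1 (by omega)
  rw [if_pos rfl] at h0
  rw [if_neg (by omega)] at hl
  have hx0 : x ∈ L.getD 0 ∅ ∩ W := by rw [h0]; simp
  rw [Finset.mem_inter] at hx0
  ext v
  simp only [Finset.mem_inter, Finset.mem_singleton, Finset.mem_sdiff]
  constructor
  · rintro ⟨a, b, c⟩
    have : v ∈ L.getD 0 ∅ ∩ W := Finset.mem_inter.2 ⟨b, he a⟩
    rw [h0] at this; simpa using this
  · rintro rfl
    refine ⟨hx, hx0.1, fun hc => ?_⟩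
    have : v ∈ L.getD 1 ∅ ∩ W := Finset.mem_inter.2 ⟨hc, hx0.2⟩
    rw [hl] at this
    split_ifs at this
    · simp at this; exact h3 this
    · simp at this

lemma Conn.last {W : Finset V} {L : List (Finset V)} {x y : V} (h : Conn W L x y)
    {e : Finset V} (he : e ⊆ W) (hy : y ∈ e) :
    e ∩ (L.getD (L.length - 1) ∅ \ L.getD (L.length - 2) ∅) = {y} := by
  obtain ⟨h1, h2, h3, h4⟩ := h
  have h0 := h4 (L.length - 1) (by omega)
  have hl := h4 (L.length - 2) (by omega)
  rw [if_neg (by omega), if_pos rfl] at h0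
  rw [if_neg (c := L.length - 2 = L.length - 1) (by omega)] at hl
  have hx0 : y ∈ L.getD (L.length - 1) ∅ ∩ W := by rw [h0]; simp
  rw [Finset.mem_inter] at hx0
  ext v
  simp only [Finset.mem_inter, Finset.mem_singleton, Finset.mem_sdiff]
  constructor
  · rintro ⟨a, b, c⟩
    have : v ∈ L.getD (L.length - 1) ∅ ∩ W := Finset.mem_inter.2 ⟨b, he a⟩
    rw [h0] at this; simpa using this
  · rintro rfl
    refine ⟨hy, hx0.1, fun hc => ?_⟩
    have : v ∈ L.getD (L.length - 2) ∅ ∩ W := Finset.mem_inter.2 ⟨hc, hx0.2⟩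
    rw [hl] at this
    split_ifs at this
    · simp at this; exact h3 this.symm
    · simp at this

lemma Conn.valid (hk : 3 ≤ k) {A L : List (Finset V)} {x y : V} (h : Conn (vset A) L x y)
    (hA : Valid k A) (hUA : UL k A) (hUL : UL k L) : Valid k (A ++ L) := by
  obtain ⟨h1, h2, h3, h4⟩ := h
  refine valid_attach hk hA hUA hUL h1 ?_ ?_
  · rw [h4 0 (by omega), if_pos rfl]; simp
  · intro i hi
    rw [h4 i hi]
    split_ifs <;> simp

lemma bic_spoiled (hk : 3 ≤ k) (hunif : Uniform k E) {e₁ e₂ : Finset V} {L : List (Finset V)}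
    {x y : V} (hP : OverlapPair k [e₁, e₂]) (h1E : e₁ ∈ E) (h2E : e₂ ∈ E)
    (hLE : ∀ e ∈ L, e ∈ E) (hL : Conn (vset [e₁, e₂]) L x y) (hx2 : x ∈ e₂) (hx1 : x ∉ e₁)
    (hy1 : y ∈ e₁) (hy2 : y ∉ e₂) : ContainsBicycle k E := by
  have hPE : ∀ e ∈ [e₁, e₂], e ∈ E := by
    intro e he
    simp at he
    rcases he with rfl | rfl <;> assumption
  have hl := hL.2.1
  have hs1 : e₂ \ e₁ ⊆ vset [e₁, e₂] := by intro v; simp; tauto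
  have hs2 : e₁ \ e₂ ⊆ vset [e₁, e₂] := by intro v; simp; tauto
  have hf := hL.first hs1 (Finset.mem_sdiff.2 ⟨hx2, hx1⟩)
  have hla := hL.last hs2 (Finset.mem_sdiff.2 ⟨hy1, hy2⟩)
  refine ⟨[e₁, e₂] ++ L, toFinset_sub ?_, Or.inl ⟨?_, ?_, e₁, e₂, L, rfl, hP, hL.1, x, y,
    hL.2.2.1, hL.inter, by rw [if_pos hl]; exact hf, by rw [if_pos hl]; exact hla⟩⟩
  · intro e he
    rcases List.mem_append.1 he with he | he
    exacts [hPE e he, hLE e he]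
  · exact hL.valid hk (OPorLC.valid hk (Or.inl hP)) (ul_of hunif hPE) (ul_of hunif hLE)
  · refine chain_append hP.chain hL.1.chain fun _ => ⟨x, ?_⟩
    have : x ∈ (e₂ \ e₁) ∩ (L.getD 0 ∅ \ L.getD 1 ∅) := by rw [hf]; simp
    simp only [Finset.mem_inter, Finset.mem_sdiff] at this ⊢
    exact ⟨by simpa using hx2, this.2.1⟩

lemma bic_dlc (hk : 3 ≤ k) (hunif : Uniform k E) {C L : List (Finset V)}
    {x y : V} (hC : LooseCycle C) (hCE : ∀ e ∈ C, e ∈ E)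
    (hLE : ∀ e ∈ L, e ∈ E) (hL : Conn (vset C) L x y) : ContainsBicycle k E := by
  have hxC : x ∈ vset C ∧ y ∈ vset C := by
    have h1 : x ∈ vset C ∩ vset L := by rw [hL.inter]; simp
    have h2 : y ∈ vset C ∩ vset L := by rw [hL.inter]; simp
    exact ⟨(Finset.mem_inter.1 h1).1, (Finset.mem_inter.1 h2).1⟩
  obtain ⟨C', hC1, hCm, hCl⟩ := hC.to_last hxC.1
  have hCV := vset_congr hCm
  have hCE' : ∀ e ∈ C', e ∈ E := fun e he => hCE e ((hCm e).1 he)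
  rw [← hCV] at hL hxC
  have hl := hL.2.1
  obtain ⟨a, ha⟩ := mem_vset_getD.1 hxC.2
  have hs : ∀ i, C'.getD i ∅ ⊆ vset C' := fun i v hv => mem_vset_getD.2 ⟨i, hv⟩
  have hf := hL.first (hs _) hCl
  have hla := hL.last (hs _) ha
  refine ⟨C' ++ L, toFinset_sub ?_, Or.inr (Or.inr (Or.inl ⟨?_, ?_, C', L, rfl, hC1, hL.1, hl, x, y,
    hL.2.2.1, hL.inter, by rw [Finset.inter_comm]; exact hf, a, lt_of_mem_getD ha,
    by rw [Finset.inter_comm]; exact hla⟩))⟩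
  · intro e he
    rcases List.mem_append.1 he with he | he
    exacts [hCE' e he, hLE e he]
  · exact hL.valid hk (OPorLC.valid hk (Or.inr hC1)) (ul_of hunif hCE') (ul_of hunif hLE)
  · refine chain_append hC1.chain hL.1.chain fun _ => ⟨x, ?_⟩
    have : x ∈ C'.getD (C'.length - 1) ∅ ∩ (L.getD 0 ∅ \ L.getD 1 ∅) := by rw [hf]; simp
    simp only [Finset.mem_inter, Finset.mem_sdiff] at this ⊢
    exact ⟨this.1, this.2.1⟩

lemma bic_dop (hk : 3 ≤ k) (hunif : Uniform k E) {e₁ e₂ e₃ e₄ : Finset V} {x y : V}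
    (h1 : e₁ ∈ E) (h2 : e₂ ∈ E) (h3 : e₃ ∈ E) (h4 : e₄ ∈ E) (h12 : OverlapPair k [e₁, e₂])
    (h34 : OverlapPair k [e₃, e₄]) (hc : (e₃ ∩ e₄).card ≤ k - 2) (hxy : x ≠ y)
    (hi : vset [e₁, e₂] ∩ vset [e₃, e₄] = {x, y}) (hx : (e₁ \ e₂) ∩ (e₄ \ e₃) = {x})
    (hy : (e₂ \ e₁) ∩ (e₃ \ e₄) = {y}) : ContainsBicycle k E := by
  have hm : ∀ v, v ∈ vset [e₁, e₂] → v ∈ vset [e₃, e₄] → v = x ∨ v = y := by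
    intro v a b
    have : v ∈ vset [e₁, e₂] ∩ vset [e₃, e₄] := Finset.mem_inter.2 ⟨a, b⟩
    rw [hi] at this; simpa using this
  have hx' : x ∈ (e₁ \ e₂) ∩ (e₄ \ e₃) := by rw [hx]; simp
  have hy' : y ∈ (e₂ \ e₁) ∩ (e₃ \ e₄) := by rw [hy]; simp
  simp only [vset_cons, vset_nil, Finset.union_empty, Finset.mem_union] at hm
  simp only [Finset.mem_inter, Finset.mem_sdiff] at hx' hy'
  have hPE : ∀ e ∈ [e₁, e₂], e ∈ E := by
    intro e he
    simp at he
    rcases he with rfl | rfl <;> assumption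
  have hPE3 : ∀ e ∈ [e₁, e₂] ++ [e₃], e ∈ E := by
    intro e he
    simp at he
    rcases he with rfl | rfl | rfl <;> assumption
  have hPE' : ∀ e ∈ [e₁, e₂] ++ [e₃] ++ [e₄], e ∈ E := by
    intro e he
    simp at he
    rcases he with rfl | rfl | rfl | rfl <;> assumption
  have i3 : e₃ ∩ vset [e₁, e₂] = {y} := by
    ext v
    simp only [vset_cons, vset_nil, Finset.union_empty, Finset.mem_union, Finset.mem_inter,
      Finset.mem_singleton]
    constructor
    · rintro ⟨a, b⟩
      rcases hm v b (Or.inl a) with rfl | rfl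
      · exact absurd a hx'.2.2
      · rfl
    · rintro rfl; exact ⟨hy'.2.1, Or.inr hy'.1.1⟩
  have i4 : e₄ ∩ vset ([e₁, e₂] ++ [e₃]) = insert x (e₃ ∩ e₄) := by
    ext v
    simp only [vset_append, vset_cons, vset_nil, Finset.union_empty, Finset.mem_union,
      Finset.mem_inter, Finset.mem_insert]
    constructor
    · rintro ⟨a, b | b⟩
      · rcases hm v b (Or.inr a) with rfl | rfl
        · exact Or.inl rfl
        · exact absurd a hy'.2.2
      · exact Or.inr ⟨b, a⟩
    · rintro (rfl | ⟨a, b⟩)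
      · exact ⟨hx'.2.1, Or.inl (Or.inl hx'.1.1)⟩
      · exact ⟨b, Or.inr a⟩
  refine ⟨[e₁, e₂] ++ [e₃] ++ [e₄], toFinset_sub hPE', Or.inr (Or.inl ⟨?_, ?_, e₁, e₂, e₃, e₄, rfl,
    h12, h34, hc, x, y, hxy, hi, hx, hy⟩)⟩
  · refine valid_snoc hk (valid_snoc hk (OPorLC.valid hk (Or.inl h12)) (ul_of hunif hPE)
      (hunif _ h3) ?_ ?_) (ul_of hunif hPE3) (hunif _ h4) ?_ ?_
    · rw [i3]; simp
    · rw [i3]; simp; omega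
    · rw [i4]; exact Finset.card_pos.2 ⟨x, by simp⟩
    · rw [i4]; exact (Finset.card_insert_le _ _).trans (by omega)
  · rw [List.append_assoc]
    refine chain_append h12.chain h34.chain fun _ => ⟨y, ?_⟩
    simp [hy'.1.1, hy'.2.1]

end Bicycles
/-! ### A bad edge over a path produces a bicycle -/

section PathConfigs

variable {k : ℕ} {E : Finset (Finset V)}

lemma bic_opconn_same (hk : 3 ≤ k) (hunif : Uniform k E) {e₁ e₂ : Finset V}
    {L : List (Finset V)} {x y : V} (hP : OverlapPair k [e₁, e₂]) (h1E : e₁ ∈ E) (h2E : e₂ ∈ E)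
    (hLE : ∀ e ∈ L, e ∈ E) (hL : Conn (vset [e₁, e₂]) L x y) (hx1 : x ∈ e₁) (hy1 : y ∈ e₁) :
    ContainsBicycle k E := by
  have hin := hL.inter
  obtain ⟨hL1, hL2, hxy, hL4⟩ := hL
  have hcd : ∀ i < L.length, e₁ ∩ L.getD i ∅ =
      if i = 0 then {x} else if i = L.length - 1 then {y} else ∅ := by
    intro i hi
    rw [← hL4 i hi]
    ext v
    have h5 : v ∈ L.getD i ∅ ∩ vset [e₁, e₂] → v = x ∨ v = y := by
      intro hv
      rw [hL4 i hi] at hv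
      split_ifs at hv <;> simp at hv <;> tauto
    simp only [vset_cons, vset_nil, Finset.union_empty, Finset.mem_union,
      Finset.mem_inter] at h5 ⊢
    constructor
    · rintro ⟨a, b⟩; exact ⟨b, Or.inl a⟩
    · intro h6
      rcases h5 h6 with rfl | rfl
      · exact ⟨hx1, h6.1⟩
      · exact ⟨hy1, h6.1⟩
  have hLC : LooseCycle (e₁ :: L) := by
    refine LooseCycle.of_cons hL1 ?_ hL2 ?_
    · intro hmem
      obtain ⟨i, hi, he⟩ := exists_getD hmem
      have h6 := hcd i hi
      rw [he, Finset.inter_self] at h6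
      have h7 := hunif e₁ h1E
      have h8 : e₁.card ≤ 1 := by
        rw [h6]; split_ifs <;> simp
      omega
    · intro i hi
      rw [hcd i hi]
      split_ifs <;> simp <;> omega
  obtain ⟨a, b, hab, hne, hc2, hc3⟩ := hP
  simp only [List.cons.injEq, and_true] at hab
  obtain ⟨rfl, rfl⟩ := hab
  have hval : e₂ ∩ vset (e₁ :: L) = e₁ ∩ e₂ := by
    ext v
    have h5 : v ∈ vset [e₁, e₂] ∩ vset L → v = x ∨ v = y := by
      intro hv
      rw [hin] at hv
      simpa using hv
    simp only [vset_cons, vset_nil, Finset.union_empty, Finset.mem_union,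
      Finset.mem_inter] at h5 ⊢
    constructor
    · rintro ⟨a, b | b⟩
      · exact ⟨b, a⟩
      · rcases h5 ⟨Or.inr a, b⟩ with rfl | rfl
        · exact ⟨hx1, a⟩
        · exact ⟨hy1, a⟩
    · rintro ⟨a, b⟩; exact ⟨b, Or.inl a⟩
  refine bic_handle hk hunif (Or.inr hLC) ?_ h2E (by rw [hval]; exact hc2) (by rw [hval]; exact hc3)
  intro e he
  rcases List.mem_cons.1 he with rfl | he
  exacts [h1E, hLE e he]

lemma bic_opconn (hk : 3 ≤ k) (hunif : Uniform k E) {e₁ e₂ : Finset V}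
    {L : List (Finset V)} {x y : V} (hP : OverlapPair k [e₁, e₂]) (h1E : e₁ ∈ E) (h2E : e₂ ∈ E)
    (hLE : ∀ e ∈ L, e ∈ E) (hL : Conn (vset [e₁, e₂]) L x y) : ContainsBicycle k E := by
  have hL' : Conn (vset [e₂, e₁]) L x y := by
    rwa [vset_congr (B := [e₁, e₂]) (by intro e; simp [or_comm])]
  have hxC : x ∈ vset [e₁, e₂] ∧ y ∈ vset [e₁, e₂] := by
    have h1 : x ∈ vset [e₁, e₂] ∩ vset L := by rw [hL.inter]; simp
    have h2 : y ∈ vset [e₁, e₂] ∩ vset L := by rw [hL.inter]; simp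
    exact ⟨(Finset.mem_inter.1 h1).1, (Finset.mem_inter.1 h2).1⟩
  simp only [vset_cons, vset_nil, Finset.union_empty, Finset.mem_union] at hxC
  by_cases hs1 : x ∈ e₁ ∧ y ∈ e₁
  · exact bic_opconn_same hk hunif hP h1E h2E hLE hL hs1.1 hs1.2
  by_cases hs2 : x ∈ e₂ ∧ y ∈ e₂
  · exact bic_opconn_same hk hunif hP.swap h2E h1E hLE hL' hs2.1 hs2.2
  by_cases hx1 : x ∈ e₁
  · exact bic_spoiled hk hunif hP.swap h2E h1E hLE hL' hx1 (by tauto) (by tauto) (by tauto)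
  · exact bic_spoiled hk hunif hP h1E h2E hLE hL (by tauto) hx1 (by tauto) (by tauto)

lemma arc_aux {C : List (Finset V)} (hC : LooseCycle C) {W : Finset V} (n : ℕ) :
    ∀ (p z : V), p ≠ z → (∀ v ∈ vset C, v ∈ W ↔ v = p ∨ v = z) →
    (∀ e ∈ C, ¬ (p ∈ e ∧ z ∈ e)) → ∀ a b, a < b → b - a = n → p ∈ C.getD a ∅ → z ∈ C.getD b ∅ →
    ∃ L x y, (∀ e ∈ L, e ∈ C) ∧ Conn W L x y := by
  induction n using Nat.strong_induction_on with
  | _ n ih =>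
  intro p z hpz hW hno a b hab hn hp hz
  have hb := lt_of_mem_getD hz
  by_cases h1 : ∃ i, a < i ∧ i < b ∧ p ∈ C.getD i ∅
  · obtain ⟨i, hi1, hi2, hi3⟩ := h1
    exact ih (b - i) (by omega) p z hpz hW hno i b hi2 rfl hi3 hz
  by_cases h2 : ∃ i, a < i ∧ i < b ∧ z ∈ C.getD i ∅
  · obtain ⟨i, hi1, hi2, hi3⟩ := h2
    exact ih (i - a) (by omega) p z hpz hW hno a i hi1 rfl hp hi3
  push Not at h1 h2
  have hpb : p ∉ C.getD b ∅ := fun h => hno _ (getD_mem' hb) ⟨h, hz⟩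
  have hza : z ∉ C.getD a ∅ := fun h => hno _ (getD_mem' (by omega)) ⟨hp, h⟩
  have hcap : ∀ i, C.getD i ∅ ∩ W = (C.getD i ∅).filter (fun v => v = p ∨ v = z) := by
    intro i
    ext v
    simp only [Finset.mem_inter, Finset.mem_filter]
    constructor
    · rintro ⟨h3, h4⟩; exact ⟨h3, (hW v (mem_vset_getD.2 ⟨i, h3⟩)).1 h4⟩
    · rintro ⟨h3, h4⟩; exact ⟨h3, (hW v (mem_vset_getD.2 ⟨i, h3⟩)).2 h4⟩
  have ha' : C.getD a ∅ ∩ W = {p} := by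
    rw [hcap]; ext v; simp only [Finset.mem_filter, Finset.mem_singleton]; grind
  have hb' : C.getD b ∅ ∩ W = {z} := by
    rw [hcap]; ext v; simp only [Finset.mem_filter, Finset.mem_singleton]; grind
  have hi' : ∀ i, a < i → i < b → C.getD i ∅ ∩ W = ∅ := by
    intro i hi1 hi2
    have := h1 i hi1 hi2
    have := h2 i hi1 hi2
    rw [hcap]; ext v; simp only [Finset.mem_filter, Finset.notMem_empty]; grind
  by_cases hend : a = 0 ∧ b = C.length - 1
  · refine ⟨[C.getD b ∅, C.getD a ∅], z, p, ?_, ?_, by simp, hpz.symm, ?_⟩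
    · intro e he
      simp only [List.mem_cons, List.not_mem_nil, or_false] at he
      rcases he with rfl | rfl
      · exact getD_mem' hb
      · exact getD_mem' (by omega)
    · refine (loosePath_single _).cons ?_ ?_ ?_
      · intro h
        simp only [List.mem_singleton] at h
        rw [h] at hpb; exact hpb hp
      · rw [List.getD_cons_zero, Finset.inter_comm, hC.2.2 a b hab hb, if_pos (Or.inr hend)]
      · intro i hi0 hi; simp at hi; omega
    · intro i hi
      simp only [List.length_cons, List.length_nil] at hi ⊢
      have : i = 0 ∨ i = 1 := by omega
      rcases this with rfl | rfl
      · rw [if_pos rfl]; exact hb'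
      · simpa using ha'
  · have hlen : ((C.drop a).take (b - a + 1)).length = b - a + 1 := by simp; omega
    refine ⟨(C.drop a).take (b - a + 1), p, z, ?_, hC.segment hab hb hend, by omega, hpz, ?_⟩
    · intro e he
      exact List.mem_of_mem_drop (List.mem_of_mem_take he)
    · rw [hlen]
      intro i hi
      rw [getD_take', if_pos hi, getD_drop']
      split_ifs with h3 h4
      · subst h3; exact ha'
      · rw [show a + i = b by omega]; exact hb'
      · exact hi' _ (by omega) (by omega)

lemma arc_exists {C : List (Finset V)} (hC : LooseCycle C) {W : Finset V} {p z : V} (hpz : p ≠ z)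
    (hp : p ∈ vset C) (hz : z ∈ vset C) (hW : ∀ v ∈ vset C, v ∈ W ↔ v = p ∨ v = z)
    (hno : ∀ e ∈ C, ¬ (p ∈ e ∧ z ∈ e)) :
    ∃ L x y, (∀ e ∈ L, e ∈ C) ∧ Conn W L x y := by
  obtain ⟨a, ha⟩ := mem_vset_getD.1 hp
  obtain ⟨b, hb⟩ := mem_vset_getD.1 hz
  rcases lt_trichotomy a b with h | rfl | h
  · exact arc_aux hC _ p z hpz hW hno a b h rfl ha hb
  · exact absurd ⟨ha, hb⟩ (hno _ (getD_mem' (lt_of_mem_getD ha)))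
  · exact arc_aux hC _ z p hpz.symm (fun v hv => (hW v hv).trans or_comm)
      (fun e he h => hno e he h.symm) b a h rfl hb ha

lemma PathR.suffix {W : Finset V} {A B : List (Finset V)} (h : PathR W (A ++ B)) :
    PathR W B := by
  induction A with
  | nil => exact h
  | cons a A ih => exact ih h.1

lemma PathR.exists_front {W : Finset V} {R : List (Finset V)} (h : PathR W R) {v : V}
    (hv : v ∈ W ∪ vset R) : ∃ A B, R = A ++ B ∧ v ∈ front W B := by
  induction R with
  | nil => exact ⟨[], [], rfl, by simpa [front] using hv⟩
  | cons g R ih =>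
    by_cases hv' : v ∈ W ∪ vset R
    · obtain ⟨A, B, rfl, h2⟩ := ih h.1 hv'
      exact ⟨g :: A, B, rfl, h2⟩
    · refine ⟨[], g :: R, rfl, ?_⟩
      simp only [front, Finset.mem_sdiff]
      refine ⟨?_, hv'⟩
      simp only [vset_cons, Finset.mem_union] at hv hv'
      tauto

lemma PathR.disj {W : Finset V} {A B : List (Finset V)} {g : Finset V}
    (h : PathR W (A ++ g :: B)) {v : V} (hv : v ∈ vset A) : v ∉ W ∪ vset B := by
  induction A with
  | nil => simp at hv
  | cons a A ih =>
    have h' : PathR W (a :: (A ++ g :: B)) := h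
    obtain ⟨h1, u, hu, ha⟩ := h'
    rw [vset_cons, Finset.mem_union] at hv
    rcases hv with hv | hv
    · intro hc
      have h3 : v ∈ a ∩ (W ∪ vset (A ++ g :: B)) := by
        simp only [Finset.mem_inter, vset_append, vset_cons, Finset.mem_union] at hc ⊢
        tauto
      rw [ha, Finset.mem_singleton] at h3
      subst h3
      cases A with
      | nil =>
        simp only [List.nil_append, front, Finset.mem_sdiff] at hu
        exact hu.2 hc
      | cons c A =>
        simp only [List.cons_append, front, Finset.mem_sdiff, Finset.mem_union, vset_append,
          vset_cons] at hu hc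
        tauto
    · exact ih h1 hv

lemma first_occ {R : List (Finset V)} {v : V} (h : v ∈ vset R) :
    ∃ A g B, R = A ++ g :: B ∧ v ∈ g ∧ v ∉ vset A := by
  induction R with
  | nil => simp at h
  | cons g R ih =>
    by_cases hg : v ∈ g
    · exact ⟨[], g, R, rfl, hg, by simp⟩
    · obtain ⟨A, a, B, rfl, h1, h2⟩ := ih (by simpa [hg] using h)
      exact ⟨g :: A, a, B, rfl, h1, by simp [hg]; simpa using h2⟩

lemma LoosePath.initSeg {A B : List (Finset V)} (h : LoosePath (A ++ B)) (hA : A ≠ []) :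
    LoosePath A := by
  refine ⟨hA, h.2.1.of_append_left, ?_⟩
  intro i j hij hj
  have := h.2.2 i j hij (by rw [List.length_append]; omega)
  rwa [getD_append', getD_append', if_pos (by omega), if_pos hj] at this

end PathConfigs
/-! ### The key lemmas -/

section Key

variable {k : ℕ} {E : Finset (Finset V)}

lemma mem_left_of_inter_singleton {A B : Finset V} {v : V} (h : A ∩ B = {v}) : v ∈ A ∧ v ∈ B := by
  have : v ∈ A ∩ B := by rw [h]; simp
  exact Finset.mem_inter.1 this

lemma eq_of_inter_singleton {A B : Finset V} {v : V} (h : A ∩ B = {v}) {x : V} (hA : x ∈ A)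
    (hB : x ∈ B) : x = v := by
  have : x ∈ A ∩ B := Finset.mem_inter.2 ⟨hA, hB⟩
  rw [h] at this; simpa using this

/-- A bad edge over a loose path leaving an overlapping pair or loose cycle gives a bicycle. -/
theorem pathcfg_bic (hk : 3 ≤ k) (hunif : Uniform k E) (n : ℕ) :
    ∀ (C R : List (Finset V)) (f : Finset V), R.length = n → OPorLC k C → (∀ e ∈ C, e ∈ E) →
    (∀ e ∈ R, e ∈ E) → f ∈ E → PathR (vset C) R → 2 ≤ (f ∩ (vset C ∪ vset R)).card →
    (f ∩ (vset C ∪ vset R)).card ≤ k - 1 → ContainsBicycle k E := by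
  induction n using Nat.strong_induction_on with
  | _ n ih =>
  intro C R f hn hC hCE hRE hfE hR h2 h3
  cases R with
  | nil => exact bic_handle hk hunif hC hCE hfE (by simpa using h2) (by simpa using h3)
  | cons g R =>
  have hR0 := hR
  obtain ⟨hR', p, hp, hgp⟩ := hR
  have hgE : g ∈ E := hRE g (by simp)
  have hRE' : ∀ e ∈ R, e ∈ E := fun e he => hRE e (by simp [he])
  set W' := vset C ∪ vset R with hW'
  have hWW : vset C ∪ vset (g :: R) = W' ∪ g := by
    rw [hW', vset_cons]; ext v; simp only [Finset.mem_union]; tauto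
  rw [hWW] at h2 h3
  have hdist : f ∩ (W' ∪ g) = (f ∩ W') ∪ (f ∩ g) := Finset.inter_union_distrib_left _ _ _
  by_cases hf2 : 2 ≤ (f ∩ W').card
  · refine ih R.length (by simp at hn; omega) C R f rfl hC hCE hRE' hfE hR' hf2 ?_
    refine le_trans (Finset.card_le_card ?_) h3
    rw [hdist]; exact Finset.subset_union_left
  have hfg : f ≠ g := by
    rintro rfl
    have : f ∩ (W' ∪ f) = f := Finset.inter_eq_left.2 Finset.subset_union_right
    rw [this, hunif f hfE] at h3
    omega
  have hpg := mem_left_of_inter_singleton hgp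
  have hgu : ∀ x ∈ g, x ∈ W' → x = p := fun x a b => eq_of_inter_singleton hgp a b
  have hDE : ∀ e ∈ [g, f], e ∈ E := by
    intro e he
    simp at he
    rcases he with rfl | rfl <;> assumption
  by_cases hz : ∀ z ∈ f ∩ W', z = p
  · -- the pair `g, f` hangs at `p`
    have hfW : f ∩ (W' ∪ g) = g ∩ f := by
      rw [hdist]
      ext v
      simp only [Finset.mem_union, Finset.mem_inter] at hz ⊢
      constructor
      · rintro (h | h)
        · have := hz v h
          subst this
          exact ⟨hpg.1, h.1⟩
        · exact ⟨h.2, h.1⟩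
      · rintro ⟨h, h'⟩; exact Or.inr ⟨h', h⟩
    rw [hfW] at h2 h3
    refine bic_ctc hk hunif (D := [g, f]) hC hCE (Or.inl ⟨g, f, rfl, hfg.symm, h2, h3⟩) hDE hRE'
      hR' hp ?_
    ext v
    simp only [vset_cons, vset_nil, Finset.union_empty, Finset.mem_inter, Finset.mem_singleton]
    constructor
    · rintro ⟨h4, h5⟩
      rcases Finset.mem_union.1 h4 with h4 | h4
      · exact hgu v h4 h5
      · exact hz v (Finset.mem_inter.2 ⟨h4, h5⟩)
    · rintro rfl
      exact ⟨Finset.mem_union_left _ hpg.1, hpg.2⟩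
  push Not at hz
  obtain ⟨z, hzf, hzp⟩ := hz
  have hfz : f ∩ W' = {z} := by
    have : (f ∩ W').card = 1 := by
      have := Finset.card_pos.2 ⟨z, hzf⟩
      omega
    obtain ⟨z', hz'⟩ := Finset.card_eq_one.1 this
    rw [hz'] at hzf ⊢
    simp at hzf
    rw [hzf]
  have hfu : ∀ x ∈ f, x ∈ W' → x = z := fun x a b => eq_of_inter_singleton hfz a b
  rw [Finset.mem_inter] at hzf
  have hzg : z ∉ g := fun h => hzp (hgu z h hzf.2)
  have hpf : p ∉ f := fun h => hzp (hfu p h hpg.2).symm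
  have hcard : (f ∩ (W' ∪ g)).card = (f ∩ g).card + 1 := by
    rw [hdist, hfz, ← Finset.insert_eq, Finset.card_insert_of_notMem (by simp [hzg])]
  rw [hcard] at h2 h3
  by_cases ha : 2 ≤ (f ∩ g).card
  · -- `g, f` is an overlapping pair attached at the two vertices `p`, `z`
    have hOP : OverlapPair k [g, f] :=
      ⟨g, f, rfl, hfg.symm, by rwa [Finset.inter_comm], by rw [Finset.inter_comm]; omega⟩
    have hWD : ∀ v ∈ W', v ∈ vset [g, f] ↔ v = p ∨ v = z := by
      intro v hv
      simp only [vset_cons, vset_nil, Finset.union_empty, Finset.mem_union]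
      constructor
      · rintro (h | h)
        · exact Or.inl (hgu v h hv)
        · exact Or.inr (hfu v h hv)
      · rintro (rfl | rfl)
        · exact Or.inl hpg.1
        · exact Or.inr hzf.1
    by_cases hcom : ∃ h ∈ E, h ⊆ W' ∧ p ∈ h ∧ z ∈ h
    · obtain ⟨h, hhE, hhW, hph, hzh⟩ := hcom
      have : h ∩ vset [g, f] = {p, z} := by
        ext v
        simp only [Finset.mem_inter, Finset.mem_insert, Finset.mem_singleton]
        constructor
        · rintro ⟨h5, h6⟩; exact (hWD v (hhW h5)).1 h6
        · intro h5
          have h6 : v ∈ h := by rcases h5 with rfl | rfl <;> assumption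
          exact ⟨h6, (hWD v (hhW h6)).2 h5⟩
      have hc : (h ∩ vset [g, f]).card = 2 := by rw [this, Finset.card_pair hzp.symm]
      exact bic_handle hk hunif (Or.inl hOP) hDE hhE (by omega) (by omega)
    obtain ⟨A, B, hAB, hzB⟩ := hR'.exists_front hzf.2
    cases A with
    | cons a A =>
      have hBW : vset C ∪ vset B ⊆ W' := by
        rw [hW', hAB, vset_append]
        intro v; simp only [Finset.mem_union]; tauto
      have hfB : f ∩ (vset C ∪ vset B) = {z} := by
        ext v
        rw [Finset.mem_inter, Finset.mem_singleton]
        constructor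
        · rintro ⟨h5, h6⟩; exact hfu v h5 (hBW h6)
        · rintro rfl; exact ⟨hzf.1, front_subset _ _ hzB⟩
      have hPB : PathR (vset C) (f :: B) := by
        refine ⟨?_, z, hzB, hfB⟩
        rw [hAB] at hR'
        exact hR'.suffix
      refine ih (f :: B).length ?_ C (f :: B) g rfl hC hCE ?_ hgE hPB ?_ ?_
      · rw [← hn, hAB]; simp
      · intro e he
        rcases List.mem_cons.1 he with rfl | he
        · exact hfE
        · exact hRE' e (by rw [hAB]; simp [he])
      · refine le_trans ha (Finset.card_le_card ?_)
        intro v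
        simp only [vset_cons, Finset.mem_inter, Finset.mem_union]
        tauto
      · have : g ∩ (vset C ∪ vset (f :: B)) ⊆ insert p (f ∩ g) := by
          intro v hv
          rw [Finset.mem_inter, vset_cons] at hv
          rw [Finset.mem_insert, Finset.mem_inter]
          by_cases hvf : v ∈ f
          · exact Or.inr ⟨hvf, hv.1⟩
          · left
            refine hgu v hv.1 (hBW ?_)
            have := hv.2
            simp only [Finset.mem_union] at this ⊢
            tauto
        have h5 := (Finset.card_le_card this).trans (Finset.card_insert_le _ _)
        omega
    | nil =>
      rw [List.nil_append] at hAB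
      subst hAB
      cases R with
      | cons h R =>
        refine absurd ⟨h, hRE' h (by simp), ?_, ?_, ?_⟩ hcom
        · rw [hW']; exact (subset_vset (by simp)).trans Finset.subset_union_right
        · simp only [front, Finset.mem_sdiff] at hp; exact hp.1
        · simp only [front, Finset.mem_sdiff] at hzB; exact hzB.1
      | nil =>
        have hWC : W' = vset C := by rw [hW']; simp
        simp only [hWC] at *
        rcases hC with hC | hC
        · obtain ⟨e₁, e₂, rfl, -⟩ := id hC
          have h1E : e₁ ∈ E := hCE _ (by simp)
          have h2E : e₂ ∈ E := hCE _ (by simp)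
          have hn1 : ¬ (p ∈ e₁ ∧ z ∈ e₁) := fun h =>
            hcom ⟨e₁, h1E, subset_vset (by simp), h.1, h.2⟩
          have hn2 : ¬ (p ∈ e₂ ∧ z ∈ e₂) := fun h =>
            hcom ⟨e₂, h2E, subset_vset (by simp), h.1, h.2⟩
          have hmem : ∀ v, v ∈ vset [e₁, e₂] ↔ v ∈ e₁ ∨ v ∈ e₂ := by intro v; simp
          simp only [hmem] at hgu hfu hpg hzf
          have hpe := hpg.2
          have hze := hzf.2
          have hpg1 := hpg.1
          have hzf1 := hzf.1
          have hgu' := hgu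
          have hfu' := hfu
          by_cases hp1 : p ∈ e₁
          · refine bic_dop hk hunif (x := p) (y := z) h1E h2E hfE hgE hC hOP.swap (by omega)
              hzp.symm ?_ ?_ ?_
            · ext v; simp only [vset_cons, vset_nil, Finset.union_empty, Finset.mem_inter,
                Finset.mem_union, Finset.mem_insert, Finset.mem_singleton]; grind
            · ext v; simp only [Finset.mem_inter, Finset.mem_sdiff, Finset.mem_singleton]; grind
            · ext v; simp only [Finset.mem_inter, Finset.mem_sdiff, Finset.mem_singleton]; grind
          · refine bic_dop hk hunif (x := p) (y := z) h2E h1E hfE hgE hC.swap hOP.swap (by omega)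
              hzp.symm ?_ ?_ ?_
            · ext v; simp only [vset_cons, vset_nil, Finset.union_empty, Finset.mem_inter,
                Finset.mem_union, Finset.mem_insert, Finset.mem_singleton]; grind
            · ext v; simp only [Finset.mem_inter, Finset.mem_sdiff, Finset.mem_singleton]; grind
            · ext v; simp only [Finset.mem_inter, Finset.mem_sdiff, Finset.mem_singleton]; grind
        · obtain ⟨L, x, y, hLC, hL⟩ := arc_exists hC hzp.symm hpg.2 hzf.2 hWD
            (fun e he h => hcom ⟨e, hCE e he, subset_vset he, h.1, h.2⟩)
          exact bic_opconn hk hunif hOP hgE hfE (fun e he => hCE e (hLC e he)) hL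
  -- now `f` meets `g` in exactly one vertex
  have ha1 : (f ∩ g).card = 1 := by omega
  obtain ⟨q, hq⟩ := hR0.hang hk (ul_of hunif hRE) (by simp)
  by_cases hzR : z ∈ vset R
  · obtain ⟨A, h, B, hAB, hzh, hzA⟩ := first_occ hzR
    have hRl : g :: R = (g :: A ++ [h]) ++ B := by rw [hAB]; simp
    have hX : LoosePath (g :: A ++ [h]) := by
      have := hq.1
      rw [hRl] at this
      exact this.initSeg (by simp)
    have hPh : PathR (vset C) (h :: B) := by
      rw [hAB] at hR'; exact hR'.suffix
    obtain ⟨hPB, p', hp', hhp'⟩ := hPh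
    have hdis : ∀ v ∈ vset (g :: A), v ∉ vset C ∪ vset B := by
      intro v hv
      have hh : PathR (vset C) ((g :: A) ++ h :: B) := by
        rw [hAB] at hR0; exact hR0
      exact hh.disj hv
    have hRW : ∀ e ∈ R, e ⊆ W' := fun e he =>
      (subset_vset he).trans Finset.subset_union_right
    have hBW : vset C ∪ vset B ⊆ W' := by
      rw [hW', hAB, vset_append, vset_cons]
      intro v; simp only [Finset.mem_union]; tauto
    have hhR : h ∈ R := by rw [hAB]; simp
    have hfR : f ∉ g :: A ++ [h] := by
      intro hmem
      have : f ∈ R := by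
        rw [hAB]
        simp only [List.cons_append, List.mem_cons, List.mem_append, List.not_mem_nil,
          or_false] at hmem ⊢
        tauto
      have h5 : f ∩ W' = f := Finset.inter_eq_left.2 (hRW f this)
      rw [h5] at hfz
      have h6 := hunif f hfE
      rw [hfz] at h6
      simp at h6; omega
    have hD : LooseCycle (f :: (g :: A ++ [h])) := by
      refine LooseCycle.of_cons hX hfR (by simp) ?_
      intro i hi
      have hlen : (g :: A ++ [h]).length = A.length + 2 := by simp
      rw [hlen] at hi ⊢
      rcases Nat.eq_zero_or_pos i with rfl | hi0
      · simpa using ha1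
      · obtain ⟨i, rfl⟩ : ∃ j', i = j' + 1 := ⟨i - 1, by omega⟩
        rw [List.cons_append, List.getD_cons_succ, getD_append']
        by_cases hil : i < A.length
        · rw [if_pos hil, if_neg (by omega), Finset.card_eq_zero,
            Finset.eq_empty_iff_forall_notMem]
          intro v hv
          rw [Finset.mem_inter] at hv
          have hvA : v ∈ vset A := mem_vset_getD.2 ⟨i, hv.2⟩
          have : v = z := by
            refine hfu v hv.1 ?_
            rw [hW', hAB, vset_append]
            simp [hvA]
          subst this
          exact hzA hvA
        · have : i = A.length := by omega
          subst this
          rw [if_neg (by omega), if_pos (by omega), Nat.sub_self, List.getD_cons_zero]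
          have : f ∩ h = {z} := by
            ext v
            rw [Finset.mem_inter, Finset.mem_singleton]
            constructor
            · rintro ⟨h5, h6⟩; exact hfu v h5 (hRW h hhR h6)
            · rintro rfl; exact ⟨hzf.1, hzh⟩
          rw [this]; simp
    refine bic_ctc hk hunif (D := f :: (g :: A ++ [h])) (R := B) hC hCE (Or.inr hD) ?_ ?_ hPB hp' ?_
    · intro e he
      rcases List.mem_cons.1 he with rfl | he
      · exact hfE
      · exact hRE e (by rw [hRl]; exact List.mem_append_left _ he)
    · intro e he
      exact hRE' e (by rw [hAB]; simp [he])
    · have hpp := mem_left_of_inter_singleton hhp'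
      ext v
      rw [Finset.mem_inter, Finset.mem_singleton]
      constructor
      · rintro ⟨h5, h6⟩
        rw [vset_cons, vset_append, Finset.mem_union, Finset.mem_union] at h5
        rcases h5 with h5 | h5 | h5
        · have := hfu v h5 (hBW h6)
          subst this
          exact eq_of_inter_singleton hhp' hzh h6
        · exact absurd h6 (hdis v h5)
        · exact eq_of_inter_singleton hhp' (by simpa using h5) h6
      · rintro rfl
        refine ⟨?_, hpp.2⟩
        rw [vset_cons, vset_append]
        simp [hpp.1]
  · -- the path returns to `C`
    have hzC : z ∈ vset C := (Finset.mem_union.1 hzf.2).resolve_right hzR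
    have hzR2 : z ∉ vset (g :: R) := by simp [hzg, hzR]
    have hqq := mem_left_of_inter_singleton hq.inter
    have hconn : Conn (vset C) (f :: g :: R) z q := by
      refine ⟨hq.1.cons ?_ (by simpa using ha1) ?_, by simp, ?_, ?_⟩
      · intro hmem
        exact hzR2 (subset_vset hmem hzf.1)
      · intro i hi0 hi
        obtain ⟨i, rfl⟩ : ∃ j', i = j' + 1 := ⟨i - 1, by omega⟩
        rw [List.getD_cons_succ, Finset.eq_empty_iff_forall_notMem]
        intro v hv
        rw [Finset.mem_inter] at hv
        have hvR : v ∈ vset R := mem_vset_getD.2 ⟨i, hv.2⟩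
        have := hfu v hv.1 (Finset.mem_union_right _ hvR)
        subst this
        exact hzR hvR
      · rintro rfl; exact hzR2 hqq.1
      · intro i hi
        rcases Nat.eq_zero_or_pos i with rfl | hi0
        · rw [if_pos rfl, List.getD_cons_zero]
          ext v
          rw [Finset.mem_inter, Finset.mem_singleton]
          constructor
          · rintro ⟨h5, h6⟩; exact hfu v h5 (Finset.mem_union_left _ h6)
          · rintro rfl; exact ⟨hzf.1, hzC⟩
        · obtain ⟨i, rfl⟩ : ∃ j', i = j' + 1 := ⟨i - 1, by omega⟩
          rw [List.getD_cons_succ, if_neg (by omega), hq.2 i (by simpa using hi)]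
          refine if_congr ?_ rfl rfl
          simp
    have hLE : ∀ e ∈ f :: g :: R, e ∈ E := by
      intro e he
      rcases List.mem_cons.1 he with rfl | he
      exacts [hfE, hRE e he]
    rcases hC with hC | hC
    · obtain ⟨e₁, e₂, rfl, -⟩ := id hC
      exact bic_opconn hk hunif hC (hCE _ (by simp)) (hCE _ (by simp)) hLE hconn
    · exact bic_dlc hk hunif hC hCE hLE hconn

lemma two_paths (hk : 3 ≤ k) (hunif : Uniform k E) (hnob : ¬ ContainsBicycle k E)
    {C : List (Finset V)} (hC : OPorLC k C) (hCE : ∀ e ∈ C, e ∈ E) (P : List (Finset V)) :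
    ∀ (Q : List (Finset V)) (g : Finset V) (v : V), (∀ e ∈ P, e ∈ E) → (∀ e ∈ g :: Q, e ∈ E) →
    PathR (vset C) P → PathR (vset C) (g :: Q) → g ∩ (vset C ∪ vset P) = {v} →
    v ∉ vset C ∪ vset Q → v ∈ front (vset C) P → False := by
  induction P with
  | nil =>
    intro Q g v _ _ _ _ _ h1 h2
    exact h1 (Finset.mem_union_left _ h2)
  | cons h P ih =>
    intro Q g v hPE hQE hP hQ hgv hvQ hv
    obtain ⟨hP', p, hp, hhp⟩ := hP
    simp only [front, Finset.mem_sdiff] at hv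
    have hhE : h ∈ E := hPE h (by simp)
    have hhk := hunif h hhE
    have hQE' : ∀ e ∈ Q, e ∈ E := fun e he => hQE e (by simp [he])
    have hgv' := mem_left_of_inter_singleton hgv
    have hc1 : (h ∩ (vset C ∪ vset Q)).card ≤ 1 := by
      by_contra hcon
      refine hnob (pathcfg_bic hk hunif _ C Q h rfl hC hCE hQE' hhE hQ.1 (by omega) ?_)
      have : h ∩ (vset C ∪ vset Q) ⊂ h := by
        refine Finset.ssubset_iff_subset_ne.2 ⟨Finset.inter_subset_left, fun he => ?_⟩
        exact hvQ (Finset.inter_eq_left.1 he hv.1)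
      have := Finset.card_lt_card this
      omega
    have hsub : h ∩ (vset C ∪ vset (g :: Q)) ⊆ insert v (h ∩ (vset C ∪ vset Q)) := by
      intro x hx
      rw [Finset.mem_inter] at hx
      rw [Finset.mem_insert, Finset.mem_inter]
      by_cases hxQ : x ∈ vset C ∪ vset Q
      · exact Or.inr ⟨hx.1, hxQ⟩
      · left
        have hxg : x ∈ g := by
          have := hx.2
          simp only [vset_cons, Finset.mem_union] at this hxQ
          tauto
        exact eq_of_inter_singleton hgv hxg (by simp [hx.1])
    have hc2 := (Finset.card_le_card hsub).trans (Finset.card_insert_le _ _)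
    have hc3 : (h ∩ (vset C ∪ vset (g :: Q))).card ≤ 1 := by
      by_contra hcon
      exact hnob (pathcfg_bic hk hunif _ C (g :: Q) h rfl hC hCE hQE hhE hQ (by omega) (by omega))
    have hvm : v ∈ h ∩ (vset C ∪ vset (g :: Q)) := by simp [hv.1, hgv'.1]
    have hhv : h ∩ (vset C ∪ vset (g :: Q)) = {v} := by
      obtain ⟨w, hw⟩ := Finset.card_eq_one.1
        (le_antisymm hc3 (Finset.card_pos.2 ⟨v, hvm⟩))
      rw [hw] at hvm ⊢
      simp at hvm
      rw [hvm]
    have hpp := mem_left_of_inter_singleton hhp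
    refine ih (g :: Q) h p (fun e he => hPE e (by simp [he])) ?_ hP' ⟨hQ, v, ?_, hhv⟩ hhp ?_ hp
    · intro e he
      rcases List.mem_cons.1 he with rfl | he
      exacts [hhE, hQE e he]
    · simp only [front, Finset.mem_sdiff]
      exact ⟨hgv'.1, hvQ⟩
    · intro hc
      have := eq_of_inter_singleton hhv hpp.1 hc
      subst this
      exact hv.2 hpp.2

/-- Orders built from `C` by good and `k`-bad edges. -/
inductive Built (C : List (Finset V)) : List (Finset V) → Prop
  | base : Built C C
  | snoc (l : List (Finset V)) (e : Finset V) : Built C l → e ∉ l →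
      ((e ∩ vset l).card = 1 ∨ e ⊆ vset l) → Built C (l ++ [e])

lemma Built.reach {C l : List (Finset V)} (h : Built C l) :
    vset C ⊆ vset l ∧ ∀ v ∈ vset l, ∃ R, (∀ e ∈ R, e ∈ l) ∧ PathR (vset C) R ∧
      v ∈ front (vset C) R := by
  induction h with
  | base => exact ⟨subset_rfl, fun v hv => ⟨[], by simp, trivial, hv⟩⟩
  | snoc l e hl he hor ih =>
    obtain ⟨ih1, ih2⟩ := ih
    refine ⟨ih1.trans (by rw [vset_append]; exact Finset.subset_union_left), ?_⟩
    intro v hv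
    by_cases hvl : v ∈ vset l
    · obtain ⟨R, h1, h2, h3⟩ := ih2 v hvl
      exact ⟨R, fun e he => List.mem_append_left _ (h1 e he), h2, h3⟩
    · have hve : v ∈ e := by
        simp only [vset_append, vset_cons, vset_nil, Finset.union_empty, Finset.mem_union] at hv
        tauto
      rcases hor with hor | hor
      · obtain ⟨x, hx⟩ := Finset.card_eq_one.1 hor
        have hxx := mem_left_of_inter_singleton hx
        obtain ⟨R, h1, h2, h3⟩ := ih2 x hxx.2
        have hsub : vset C ∪ vset R ⊆ vset l := by
          refine Finset.union_subset ih1 ?_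
          intro y hy
          obtain ⟨e', he', hy'⟩ := mem_vset.1 hy
          exact mem_vset.2 ⟨e', h1 e' he', hy'⟩
        refine ⟨e :: R, ?_, ⟨h2, x, h3, ?_⟩, ?_⟩
        · intro e' he'
          rcases List.mem_cons.1 he' with rfl | he'
          · simp
          · exact List.mem_append_left _ (h1 e' he')
        · ext y
          rw [Finset.mem_inter, Finset.mem_singleton]
          constructor
          · rintro ⟨h5, h6⟩; exact eq_of_inter_singleton hx h5 (hsub h6)
          · rintro rfl; exact ⟨hxx.1, front_subset _ _ h3⟩
        · simp only [front, Finset.mem_sdiff]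
          exact ⟨hve, fun h => hvl (hsub h)⟩
      · exact absurd (hor hve) hvl

/-- No edge is ever bad with respect to a built order. -/
lemma Built.no_bad (hk : 3 ≤ k) (hunif : Uniform k E) (hnob : ¬ ContainsBicycle k E)
    {C l : List (Finset V)} (hC : OPorLC k C) (h : Built C l) (hCE : ∀ e ∈ C, e ∈ E)
    (hlE : ∀ e ∈ l, e ∈ E) {f : Finset V} (hf : f ∈ E) (hns : ¬ f ⊆ vset l) :
    (f ∩ vset l).card ≤ 1 := by
  by_contra hcon
  obtain ⟨y1, hy1, y2, hy2, hne⟩ := Finset.one_lt_card.1 (by omega : 1 < (f ∩ vset l).card)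
  rw [Finset.mem_inter] at hy1 hy2
  obtain ⟨hr1, hr2⟩ := h.reach
  have key : ∀ y ∈ f, y ∈ vset l → ∃ R, (∀ e ∈ R, e ∈ E) ∧ PathR (vset C) R ∧
      y ∈ front (vset C) R ∧ f ∩ (vset C ∪ vset R) = {y} := by
    intro y hyf hyl
    obtain ⟨R, h1, h2, h3⟩ := hr2 y hyl
    have hRE : ∀ e ∈ R, e ∈ E := fun e he => hlE e (h1 e he)
    have hsub : vset C ∪ vset R ⊆ vset l := by
      refine Finset.union_subset hr1 ?_
      intro y hy
      obtain ⟨e', he', hy'⟩ := mem_vset.1 hy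
      exact mem_vset.2 ⟨e', h1 e' he', hy'⟩
    refine ⟨R, hRE, h2, h3, ?_⟩
    have hym : y ∈ f ∩ (vset C ∪ vset R) := Finset.mem_inter.2 ⟨hyf, front_subset _ _ h3⟩
    have hle : (f ∩ (vset C ∪ vset R)).card ≤ 1 := by
      by_contra hcon
      refine hnob (pathcfg_bic hk hunif _ C R f rfl hC hCE hRE hf h2 (by omega) ?_)
      have : f ∩ (vset C ∪ vset R) ⊂ f := by
        refine Finset.ssubset_iff_subset_ne.2 ⟨Finset.inter_subset_left, fun he => ?_⟩
        exact hns ((Finset.inter_eq_left.1 he).trans hsub)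
      have := Finset.card_lt_card this
      have := hunif f hf
      omega
    obtain ⟨w, hw⟩ := Finset.card_eq_one.1 (le_antisymm hle (Finset.card_pos.2 ⟨y, hym⟩))
    rw [hw] at hym ⊢
    simp at hym
    rw [hym]
  obtain ⟨P1, hP1E, hP1, hf1, hi1⟩ := key y1 hy1.1 hy1.2
  obtain ⟨P2, hP2E, hP2, hf2, hi2⟩ := key y2 hy2.1 hy2.2
  refine two_paths hk hunif hnob hC hCE P2 P1 f y2 hP2E ?_ hP2 ⟨hP1, y1, hf1, hi1⟩ hi2 ?_ hf2
  · intro e he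
    rcases List.mem_cons.1 he with rfl | he
    exacts [hf, hP1E e he]
  · intro hc
    exact hne (eq_of_inter_singleton hi1 hy2.1 hc).symm

end Key

/-! ### Building the order -/

section Final

variable {k : ℕ}

lemma Built.app {C l : List (Finset V)} (h : Built C l) (t : List (Finset V))
    (hnd : (l ++ t).Nodup) (ht : ∀ e ∈ t, e ⊆ vset l) : Built C (l ++ t) := by
  induction t generalizing l with
  | nil => simpa using h
  | cons e t ih =>
    have h1 : Built C (l ++ [e]) := by
      refine Built.snoc l e h ?_ (Or.inr (ht e (by simp)))
      intro he
      rw [List.nodup_append] at hnd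
      exact hnd.2.2 e he e (by simp) rfl
    have := ih h1 (by simpa using hnd) (by
      intro f hf
      rw [vset_append]
      exact (ht f (by simp [hf])).trans Finset.subset_union_left)
    simpa using this

lemma Built.initSeg {C l : List (Finset V)} (h : Built C l) : ∃ t, l = C ++ t := by
  induction h with
  | base => exact ⟨[], by simp⟩
  | snoc l e _ _ _ ih =>
    obtain ⟨t, rfl⟩ := ih
    exact ⟨t ++ [e], by simp⟩

lemma Built.allowed {C l : List (Finset V)} (hk : 3 ≤ k) (hC : Allowed C) (h : Built C l)
    (hU : UL k l) : Allowed l := by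
  induction h with
  | base => exact hC
  | snoc l e hl he hor ih =>
    have hU' : UL k l := fun f hf => hU f (by simp [hf])
    have ihh := ih hU'
    refine ⟨?_, ?_⟩
    · rw [List.nodup_append]
      refine ⟨ihh.1, by simp, ?_⟩
      intro a ha b hb
      simp only [List.mem_singleton] at hb
      subst hb
      rintro rfl
      exact he ha
    · intro i h0 hi
      simp only [List.length_append, List.length_singleton] at hi
      rcases Nat.lt_or_ge i l.length with hlt | hge
      · rw [oldOf_append_left hlt]; exact ihh.2 i h0 hlt
      · obtain rfl : i = l.length := by omega
        rw [oldOf_snoc]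
        rcases hor with h1 | h1
        · omega
        · rw [Finset.inter_eq_left.2 h1, hU e (by simp)]; omega

/-- The invariant of the greedy procedure. -/
def GInv (k s : ℕ) (E : Finset (Finset V)) (C τ l : List (Finset V)) : Prop :=
  Built C l ∧ (∀ e ∈ l, e ∈ E) ∧ τ.length = s ∧ (∃ ρ, l = τ ++ ρ) ∧
  (∀ j, s ≤ j → j < l.length → GoodAt l j ∨ KBadAt k l j) ∧
  (∀ j, s + 1 ≤ j → j < l.length → KBadAt k l j →
    KBadAt k l (j - 1) ∨
      ∃ x ∈ l.getD j ∅, x ∈ l.getD (j - 1) ∅ ∧ x ∉ vset (l.take (j - 1))) ∧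
  (∀ e ∈ E, e ∉ l → e ⊆ vset l → l.length = s ∨ KBadAt k l (l.length - 1) ∨
      ∃ x ∈ e, x ∈ l.getD (l.length - 1) ∅ ∧ x ∉ vset (l.take (l.length - 1)))

lemma GInv.step {s : ℕ} {E : Finset (Finset V)} (hk : 3 ≤ k) (hs : 2 ≤ s) (hunif : Uniform k E)
    (hconn : HyperConnected E) (hnob : ¬ ContainsBicycle k E)
    {C τ l : List (Finset V)} (hC : OPorLC k C) (hI : GInv k s E C τ l)
    (hne : (E \ l.toFinset).Nonempty) : ∃ e ∈ E, e ∉ l ∧ GInv k s E C τ (l ++ [e]) := by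
  obtain ⟨hB, hlE, hτ, ⟨ρ, hρ⟩, hgk, hii, hnext⟩ := hI
  have hls : s ≤ l.length := by rw [hρ, List.length_append]; omega
  obtain ⟨t, ht⟩ := hB.initSeg
  have hCE : ∀ e ∈ C, e ∈ E := fun e he => hlE e (by rw [ht]; simp [he])
  have hgetl : ∀ e, ∀ j < l.length, (l ++ [e]).getD j ∅ = l.getD j ∅ := by
    intro e j hj; rw [getD_append', if_pos hj]
  have hgete : ∀ e, (l ++ [e]).getD l.length ∅ = e := by
    intro e; rw [getD_append', if_neg (by omega)]; simp
  have htake : ∀ e, ∀ j ≤ l.length, (l ++ [e]).take j = l.take j := by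
    intro e j hj; exact List.take_append_of_le_length hj
  have hKl : ∀ e, ∀ j < l.length, (KBadAt k (l ++ [e]) j ↔ KBadAt k l j) := by
    intro e j hj; unfold KBadAt; rw [oldOf_append_left hj]
  have hGl : ∀ e, ∀ j < l.length, (GoodAt (l ++ [e]) j ↔ GoodAt l j) := by
    intro e j hj; unfold GoodAt; rw [oldOf_append_left hj]
  have main : ∀ e ∈ E, e ∉ l → ((e ∩ vset l).card = 1 ∨ e ⊆ vset l) →
      (∀ e' ∈ E, e' ∉ l ++ [e] → e' ⊆ vset (l ++ [e]) → e ⊆ vset l ∨ ∃ x ∈ e', x ∈ e ∧ x ∉ vset l) →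
      GInv k s E C τ (l ++ [e]) := by
    intro e he hel hor hnx
    have hKe : e ⊆ vset l → KBadAt k (l ++ [e]) l.length := by
      intro h; unfold KBadAt; rw [oldOf_snoc, Finset.inter_eq_left.2 h, hunif e he]
    refine ⟨Built.snoc l e hB hel hor, ?_, hτ, ⟨ρ ++ [e], by rw [hρ]; simp⟩, ?_, ?_, ?_⟩
    · intro f hf
      rcases List.mem_append.1 hf with h | h
      · exact hlE f h
      · simp only [List.mem_singleton] at h; rwa [h]
    · intro j hj1 hj2
      simp only [List.length_append, List.length_singleton] at hj2
      rcases Nat.lt_or_ge j l.length with hlt | hge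
      · rw [hGl e j hlt, hKl e j hlt]; exact hgk j hj1 hlt
      · obtain rfl : j = l.length := by omega
        rcases hor with h | h
        · left; unfold GoodAt; rw [oldOf_snoc, h]
        · right; exact hKe h
    · intro j hj1 hj2 hKj
      simp only [List.length_append, List.length_singleton] at hj2
      rcases Nat.lt_or_ge j l.length with hlt | hge
      · rw [hKl e _ (by omega), hgetl e _ hlt, hgetl e _ (by omega), htake e _ (by omega)]
        exact hii j hj1 hlt ((hKl e j hlt).1 hKj)
      · obtain rfl : j = l.length := by omega
        rw [hKl e _ (by omega), hgete e, hgetl e _ (by omega), htake e _ (by omega)]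
        have hsub : e ⊆ vset l := by
          unfold KBadAt at hKj
          rw [oldOf_snoc] at hKj
          rcases hor with h | h
          · omega
          · exact h
        rcases hnext e he hel hsub with h | h
        · omega
        · exact h
    · intro e' he' hel' hsub'
      right
      have hlen : (l ++ [e]).length - 1 = l.length := by simp
      rw [hlen, hgete e, htake e _ le_rfl, List.take_length]
      rcases hnx e' he' hel' hsub' with h | h
      · left; exact hKe h
      · right; exact h
  by_cases hex : ∃ e ∈ E, e ∉ l ∧ e ⊆ vset l
  · obtain ⟨e, he, hel, hsub⟩ := hex
    exact ⟨e, he, hel, main e he hel (Or.inr hsub) (fun _ _ _ _ => Or.inl hsub)⟩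
  · push Not at hex
    have hF : l.toFinset ⊆ E := fun f hf => hlE f (List.mem_toFinset.1 hf)
    have hFne : l.toFinset.Nonempty := by
      have h0 : 0 < l.length := by omega
      exact ⟨_, List.mem_toFinset.2 (getD_mem' h0)⟩
    obtain ⟨f, hf, e, he, hfe⟩ := hconn _ hF hFne hne
    rw [Finset.mem_sdiff, List.mem_toFinset] at he
    rw [List.mem_toFinset] at hf
    have hns := hex e he.1 he.2
    have hle := hB.no_bad hk hunif hnob hC hCE hlE he.1 hns
    have hge : 0 < (e ∩ vset l).card := by
      obtain ⟨x, hx⟩ := hfe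
      rw [Finset.mem_inter] at hx
      exact Finset.card_pos.2 ⟨x, Finset.mem_inter.2 ⟨hx.2, mem_vset.2 ⟨f, hf, hx.1⟩⟩⟩
    refine ⟨e, he.1, he.2, main e he.1 he.2 (Or.inl (by omega)) ?_⟩
    intro e' he' hel' hsub'
    right
    simp only [List.mem_append, not_or] at hel'
    have := hex e' he' hel'.1
    rw [Finset.not_subset] at this
    obtain ⟨x, hx, hxl⟩ := this
    refine ⟨x, hx, ?_, hxl⟩
    have := hsub' hx
    simp only [vset_append, vset_cons, vset_nil, Finset.mem_union] at this
    simpa [hxl] using this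

lemma GInv.complete {s : ℕ} {E : Finset (Finset V)} (hk : 3 ≤ k) (hs : 2 ≤ s)
    (hunif : Uniform k E) (hconn : HyperConnected E) (hnob : ¬ ContainsBicycle k E)
    {C τ : List (Finset V)} (hC : OPorLC k C) (n : ℕ) :
    ∀ l, (E \ l.toFinset).card = n → GInv k s E C τ l →
      ∃ l', GInv k s E C τ l' ∧ l'.toFinset = E := by
  induction n with
  | zero =>
    intro l hl hI
    refine ⟨l, hI, Finset.Subset.antisymm (fun f hf => hI.2.1 f (List.mem_toFinset.1 hf)) ?_⟩
    rw [Finset.card_eq_zero, Finset.sdiff_eq_empty_iff_subset] at hl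
    exact hl
  | succ n ih =>
    intro l hl hI
    obtain ⟨e, he, hel, hI'⟩ := hI.step hk hs hunif hconn hnob hC
      (Finset.card_pos.1 (by omega))
    refine ih (l ++ [e]) ?_ hI'
    have : E \ (l ++ [e]).toFinset = (E \ l.toFinset).erase e := by
      ext f; simp; tauto
    rw [this, Finset.card_erase_of_mem (by simp [he, hel])]
    omega

lemma klink_order {s a : ℕ} (hk : 3 ≤ k) (hs : 3 ≤ s) (ha : 1 ≤ a) (ha2 : a ≤ k / (s - 1))
    {σ : List (Finset V)} (hU : UL k σ) (h : KLink k s a σ) :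
    ∃ C, OPorLC k C ∧ Built C σ := by
  obtain ⟨hA, hlen, hv, hpair⟩ := h
  match σ, hA, hlen, hv, hpair, hU with
  | [], _, hlen, _, _, _ => simp at hlen; omega
  | [_], _, hlen, _, _, _ => simp at hlen; omega
  | e :: f :: t, hA, hlen, hv, hpair, hU =>
    have h01 := hpair 0 1 (by omega) (by omega)
    simp only [List.getD_cons_zero, List.getD_cons_succ] at h01
    have hadd := Finset.card_union_add_card_inter e f
    rw [h01, hU e (by simp), hU f (by simp)] at hadd
    have hak : 2 * a ≤ k := by
      have h1 : k / (s - 1) ≤ k / 2 := Nat.div_le_div_left (by omega) (by omega)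
      omega
    have hnd := hA.1
    refine ⟨[e, f], Or.inl ⟨e, f, rfl, ?_, by omega, by omega⟩, ?_⟩
    · rintro rfl; simp at hnd
    · have heq : e ∪ f = vset (e :: f :: t) := by
        refine Finset.eq_of_subset_of_card_le ?_ (by omega)
        intro x; simp; tauto
      have := Built.app (Built.base (C := [e, f])) t (by simpa using hnd) (by
        intro g hg
        have h1 : g ⊆ vset (e :: f :: t) := subset_vset (by simp [hg])
        rw [← heq] at h1
        simpa using h1)
      simpa using this

lemma pasch_order {σ : List (Finset V)} (h : Pasch σ) :
    ∃ C, OPorLC k C ∧ Built C σ := by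
  obtain ⟨hA, hlen, hv, hdeg, hpair⟩ := h
  obtain ⟨a, b, c, d, rfl⟩ : ∃ a b c d, σ = [a, b, c, d] := by
    match σ, hlen with
    | [a, b, c, d], _ => exact ⟨a, b, c, d, rfl⟩
  have hnd := hA.1
  have h01 := hpair 0 1 (by omega) (by omega)
  have h02 := hpair 0 2 (by omega) (by omega)
  have h12 := hpair 1 2 (by omega) (by omega)
  simp only [List.getD_cons_zero, List.getD_cons_succ] at h01 h02 h12
  refine ⟨[a, b, c], Or.inr ⟨by simp, ?_, ?_⟩, ?_⟩
  · simp at hnd ⊢; tauto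
  · intro i j hij hj
    simp only [List.length_cons, List.length_nil] at hj
    obtain ⟨rfl, rfl⟩ | ⟨rfl, rfl⟩ | ⟨rfl, rfl⟩ :
      (i = 0 ∧ j = 1) ∨ (i = 0 ∧ j = 2) ∨ (i = 1 ∧ j = 2) := by omega
    · simpa using h01
    · simpa using h02
    · simpa using h12
  · have := Built.app (Built.base (C := [a, b, c])) [d] (by simpa using hnd) (by
      intro g hg
      simp only [List.mem_singleton] at hg
      subst hg
      intro x hx
      by_contra hcon
      have h2 := hdeg x (by simp [hx])
      simp only [vset_cons, vset_nil, Finset.mem_union, not_or] at hcon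
      have : ((Finset.range 4).filter fun i => x ∈ ([a, b, c, g] : List (Finset V)).getD i ∅) ⊆ {3} := by
        intro i hi
        simp only [Finset.mem_filter, Finset.mem_range] at hi
        obtain ⟨hi, hx⟩ := hi
        interval_cases i <;> simp_all
      have h3 := Finset.card_le_card this
      rw [h2, Finset.card_singleton] at h3
      omega)
    simpa using this

lemma star_first {C l : List (Finset V)} (h : Built C l) {c : V} (hc : c ∈ vset l)
    (t : List (Finset V)) (hnd : (l ++ t).Nodup) (hct : ∀ e ∈ t, c ∈ e)
    (hlt : ∀ e ∈ t, e ∩ vset l ⊆ {c}) (htt : t.Pairwise fun e f => e ∩ f = {c}) :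
    Built C (l ++ t) := by
  induction t generalizing l with
  | nil => simpa using h
  | cons e t ih =>
    have h1 : Built C (l ++ [e]) := by
      refine Built.snoc l e h ?_ (Or.inl ?_)
      · intro he
        rw [List.nodup_append] at hnd
        exact hnd.2.2 e he e (by simp) rfl
      · rw [Finset.card_eq_one]
        refine ⟨c, Finset.Subset.antisymm (hlt e (by simp)) ?_⟩
        rw [Finset.singleton_subset_iff, Finset.mem_inter]
        exact ⟨hct e (by simp), hc⟩
    rw [List.pairwise_cons] at htt
    have := ih h1 (by rw [vset_append]; exact Finset.mem_union_left _ hc) (by simpa using hnd)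
      (fun f hf => hct f (by simp [hf])) (by
        intro f hf
        have h2 := hlt f (by simp [hf])
        have h3 := htt.1 f hf
        intro x hx
        simp only [vset_append, vset_cons, vset_nil, Finset.mem_inter, Finset.mem_union,
          Finset.notMem_empty, or_false] at hx
        rcases hx.2 with h4 | h4
        · exact h2 (Finset.mem_inter.2 ⟨hx.1, h4⟩)
        · rw [← h3]; exact Finset.mem_inter.2 ⟨h4, hx.1⟩) htt.2
    simpa using this

lemma star_order {u : ℕ} (hk : 3 ≤ k) (hu : 2 ≤ u) {σ : List (Finset V)} (hU : UL k σ)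
    (h : StarKU2 k u σ) :
    ∃ C τ, OPorLC k C ∧ Built C τ ∧ τ.Perm σ := by
  obtain ⟨hA, hlen, c₁, c₂, l₁, l₂, hc, hl₁, hl₂, hperm, hS₁, hS₂, hm⟩ := h
  match l₁, l₂, hl₁, hl₂, hperm, hS₁, hS₂, hm with
  | [], _, hl₁, _, _, _, _, _ => simp at hl₁; omega
  | _ :: _, [], _, hl₂, _, _, _, _ => simp at hl₂; omega
  | a :: A, b :: B, hl₁, hl₂, hperm, hS₁, hS₂, hm =>
    simp only [List.length_cons] at hl₁ hl₂
    have hperm' : ([a, b] ++ A ++ B).Perm σ := by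
      refine List.Perm.trans ?_ hperm
      simp only [List.cons_append, List.nil_append]
      exact List.Perm.cons a List.perm_middle.symm
    have hnd : ([a, b] ++ A ++ B).Nodup := hperm'.nodup_iff.2 hA.1
    have hU' : UL k ([a, b] ++ A ++ B) := fun e he => hU e (hperm'.mem_iff.1 he)
    have hab : a.erase c₁ = b.erase c₂ := by simpa using hm 0 (by omega)
    have hca : c₁ ∈ a := hS₁.2.2.1 a (by simp)
    have hcb : c₂ ∈ b := hS₂.2.2.1 b (by simp)
    have hAa : ∀ e ∈ A, a ∩ e = {c₁} := by
      intro e he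
      obtain ⟨i, hi, rfl⟩ := exists_getD he
      simpa using hS₁.2.2.2 0 (i + 1) (by omega) (by simpa using hi)
    have hAA : A.Pairwise fun e f => e ∩ f = {c₁} := by
      rw [List.pairwise_iff_getElem]
      intro i j hi hj hij
      have := hS₁.2.2.2 (i + 1) (j + 1) (by omega) (by simpa using hj)
      rw [List.getD_cons_succ, List.getD_cons_succ] at this
      rwa [List.getD_eq_getElem _ _ hi, List.getD_eq_getElem _ _ hj] at this
    have hmm : ∀ i < A.length, (A.getD i ∅).erase c₁ = (B.getD i ∅).erase c₂ := by
      intro i hi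
      simpa using hm (i + 1) (by omega)
    have hc2 : ∀ i < u, c₂ ∉ (a :: A).getD i ∅ := by
      intro i hi hcon
      have := hm i hi
      have h2 : c₂ ∈ ((a :: A).getD i ∅).erase c₁ := Finset.mem_erase.2 ⟨hc.symm, hcon⟩
      rw [this] at h2
      simp at h2
    have hc2a : c₂ ∉ a := by simpa using hc2 0 (by omega)
    have hc2A : ∀ e ∈ A, c₂ ∉ e := by
      intro e he
      obtain ⟨i, hi, rfl⟩ := exists_getD he
      simpa using hc2 (i + 1) (by omega)
    have hc1b : c₁ ∉ b := by
      intro hcon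
      have h2 : c₁ ∈ b.erase c₂ := Finset.mem_erase.2 ⟨hc, hcon⟩
      rw [← hab] at h2
      simp at h2
    have hb : ∀ x, x ∈ b ↔ x = c₂ ∨ (x ≠ c₁ ∧ x ∈ a) := by
      intro x
      rw [← Finset.mem_erase, hab, Finset.mem_erase]
      by_cases hx : x = c₂
      · simp [hx, hcb]
      · simp [hx]
    have hinter : a ∩ b = a.erase c₁ := by
      ext x
      simp only [Finset.mem_inter, Finset.mem_erase, hb]
      constructor
      · rintro ⟨h1, rfl | h2⟩
        · exact absurd h1 hc2a
        · exact h2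
      · rintro ⟨h1, h2⟩; exact ⟨h2, Or.inr ⟨h1, h2⟩⟩
    have hcard : (a ∩ b).card = k - 1 := by
      rw [hinter, Finset.card_erase_of_mem hca, hU' a (by simp)]
    have hB1 : Built [a, b] ([a, b] ++ A) := by
      refine star_first Built.base (c := c₁) (by simp [hca]) A (List.nodup_append.1 hnd).1 ?_ ?_ hAA
      · intro e he; exact hS₁.2.2.1 e (by simp [he])
      · intro e he x hx
        simp only [vset_cons, vset_nil, Finset.mem_inter, Finset.mem_union,
          Finset.notMem_empty, or_false] at hx
        rw [← hAa e he, Finset.mem_inter]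
        refine ⟨?_, hx.1⟩
        rcases hx.2 with h | h
        · exact h
        · rcases (hb x).1 h with rfl | h
          · exact absurd hx.1 (hc2A e he)
          · exact h.2
    refine ⟨[a, b], [a, b] ++ A ++ B, Or.inl ⟨a, b, rfl, ?_, by omega, by omega⟩, ?_, hperm'⟩
    · rintro rfl; exact hc1b hca
    · refine Built.app hB1 B hnd ?_
      intro e he x hx
      obtain ⟨i, hi, rfl⟩ := exists_getD he
      by_cases hx2 : x = c₂
      · subst hx2; simp [hcb]
      · have h1 : x ∈ (B.getD i ∅).erase c₂ := Finset.mem_erase.2 ⟨hx2, hx⟩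
        rw [← hmm i (by omega)] at h1
        rw [vset_append]
        exact Finset.mem_union_right _ (mem_vset_getD.2 ⟨i, Finset.mem_of_mem_erase h1⟩)

lemma sconfig_order {s : ℕ} (hk : 3 ≤ k) {σ : List (Finset V)} (hU : UL k σ)
    (h : SConfig k s σ) : ∃ C τ, OPorLC k C ∧ Built C τ ∧ τ.Perm σ := by
  obtain ⟨hlen, h | h | ⟨hs, u, hu, h⟩ | ⟨hs, a, ha, ha2, h⟩ | ⟨_, h⟩⟩ := h
  · exact ⟨σ, σ, Or.inl h, Built.base, List.Perm.refl _⟩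
  · exact ⟨σ, σ, Or.inr h, Built.base, List.Perm.refl _⟩
  · exact star_order hk (by omega) hU h
  · obtain ⟨C, h1, h2⟩ := klink_order hk hs ha ha2 hU h
    exact ⟨C, σ, h1, h2, List.Perm.refl _⟩
  · obtain ⟨C, h1, h2⟩ := pasch_order (k := k) h
    exact ⟨C, σ, h1, h2, List.Perm.refl _⟩

end Final

/-- Claim 3.7 of the paper. If the connected `k`-uniform hypergraph `J`
contains no bicycle and contains a configuration `S` (with `s` edges), then `E(J)` has an
allowed edge order which has a prefix forming an overlapping pair or loose cycle, whose
first `s` edges form `S`, in which every later edge is good or `k`-bad, and in which every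
`k`-bad edge `e_j` (`j ≥ s+1`) either follows another `k`-bad edge or contains a vertex
which is new in `e_{j-1}`. -/
theorem order_starting_with_config {V : Type*} [DecidableEq V] {k s : ℕ} (hk : 3 ≤ k)
    (σ : List (Finset V)) (hσ : SConfig k s σ)
    (E : Finset (Finset V)) (hunif : Uniform k E) (hconn : HyperConnected E)
    (hnob : ¬ ContainsBicycle k E) (hσE : σ.toFinset ⊆ E) :
    ∃ l : List (Finset V), Allowed l ∧ l.toFinset = E ∧
      (∃ i < s, OPorLC k (l.take (i + 1))) ∧
      (l.take s).toFinset = σ.toFinset ∧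
      (∀ j, s ≤ j → j < l.length → GoodAt l j ∨ KBadAt k l j) ∧
      (∀ j, s + 1 ≤ j → j < l.length → KBadAt k l j →
        KBadAt k l (j - 1) ∨
          ∃ x ∈ l.getD j ∅, x ∈ l.getD (j - 1) ∅ ∧ x ∉ vset (l.take (j - 1))) := by
  have hU : UL k σ := fun e he => hunif e (hσE (List.mem_toFinset.2 he))
  obtain ⟨C, τ, hC, hB, hperm⟩ := sconfig_order hk hU hσ
  have hτlen : τ.length = s := hperm.length_eq.trans hσ.1
  have hτE : ∀ e ∈ τ, e ∈ E := fun e he => hσE (List.mem_toFinset.2 (hperm.mem_iff.1 he))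
  obtain ⟨t, ht⟩ := hB.initSeg
  have hC2 := hC.two_le
  have hCs : C.length ≤ s := by rw [← hτlen, ht, List.length_append]; omega
  have hI : GInv k s E C τ τ := by
    refine ⟨hB, hτE, hτlen, ⟨[], by simp⟩, ?_, ?_, ?_⟩
    · intro j h1 h2; omega
    · intro j h1 h2; omega
    · intro e _ _ _; exact Or.inl hτlen
  obtain ⟨l, hIl, hlE⟩ := GInv.complete hk (by omega) hunif hconn hnob hC _ τ rfl hI
  obtain ⟨hBl, hl, -, ⟨ρ, hρ⟩, hgk, hii, -⟩ := hIl
  obtain ⟨t', ht'⟩ := hBl.initSeg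
  have hUl : UL k l := fun e he => hunif e (hl e he)
  have hUC : UL k C := fun e he => hUl e (by rw [ht']; simp [he])
  have hCA : Allowed C := by
    have hv := OPorLC.valid hk hC
    exact ⟨hv.1, fun i h0 hi => (hv.2 i h0 hi).1⟩
  refine ⟨l, hBl.allowed hk hCA hUl, hlE, ⟨C.length - 1, by omega, ?_⟩, ?_, hgk, hii⟩
  · have : C.length - 1 + 1 = C.length := by omega
    rw [this, ht', List.take_left]
    exact hC
  · have : l.take s = τ := by rw [hρ, ← hτlen, List.take_left]
    rw [this]
    exact List.toFinset_eq_of_perm _ _ hperm
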